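/- Let p be a prime, K a field of characteristic p, m, n ∈ ℕ, a ∈ W_m(K) and b ∈ W_n(K). Then A_{((a,b))_{p^m,p^n}} is a central simple K-algebra of degree p^{mn}: its center is exactly K, it has no two-sided ideals other than 0 and itself, and its K-dimension is p^{2mn}. -/

import Mathlib

noncomputable section

/-- The product `∏ i, x i ^ e i` over the support of `e`, with factors multiplied in
increasing order of the index. -/
def ordProd {σ M : Type*} [LinearOrder σ] [Monoid M] (x : σ → M) (e : σ →₀ ℕ) : M :=
  ((e.support.sort (· ≤ ·)).map fun i => x i ^ e i).prod

/-- Evaluation of a multivariate polynomial in a (possibly noncommutative) algebra: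
each monomial is evaluated as the ordered product of the powers of the substituted
values, the variables being multiplied in increasing order of their (linearly ordered)
index. -/
def pEval {σ R A : Type*} [LinearOrder σ] [CommSemiring R] [Semiring A] [Algebra R A]
    (x : σ → A) (q : MvPolynomial σ R) : A :=
  q.support.sum fun e => MvPolynomial.coeff e q • ordProd x e

/-- Evaluation of an integral polynomial in the commuting variables `X_d` (`d : ℕ+`, left
summand) and `Y_e` (`e : ℕ+`, right summand), substituting `x d` for `X_d` and `y e` for
`Y_e`; in each monomial all `X`-factors (in increasing index order) are multiplied to the
left of all `Y`-factors (in increasing index order), as appropriate for a polynomial in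
`ℤ[X][Y]`. -/
def cEval {A : Type*} [Ring A] (x y : ℕ+ → A) (q : MvPolynomial (ℕ+ ⊕ₗ ℕ+) ℤ) : A :=
  pEval (fun v => Sum.elim x y (ofLex v)) q

/-- The `k`-th ghost value `w_k(g) = ∑_{d ∣ k} d · (g d)^(k/d)`. -/
def ghost {A : Type*} [Ring A] (g : ℕ+ → A) (k : ℕ+) : A :=
  ∑ d ∈ (k : ℕ).divisors.attach,
    ((d : ℕ) : A) * g ⟨(d : ℕ), Nat.pos_of_mem_divisors d.2⟩ ^ ((k : ℕ) / (d : ℕ))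

/-- The generator `x_d` of the free algebra underlying `B(ℚ)`. -/
def bXf (d : ℕ+) : FreeAlgebra ℚ (ℕ+ ⊕ ℕ+) := FreeAlgebra.ι ℚ (Sum.inl d)

/-- The generator `y_e` of the free algebra underlying `B(ℚ)`. -/
def bYf (e : ℕ+) : FreeAlgebra ℚ (ℕ+ ⊕ ℕ+) := FreeAlgebra.ι ℚ (Sum.inr e)

/-- The defining relations of `B(ℚ)`: `[w_k(x), w_l(x)] = 0`, `[w_k(y), w_l(y)] = 0` and
`[w_l(y), w_k(x)] = δ_{k,l}·k` for all `k, l ≥ 1`. -/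
inductive BRel : FreeAlgebra ℚ (ℕ+ ⊕ ℕ+) → FreeAlgebra ℚ (ℕ+ ⊕ ℕ+) → Prop
  | xx (k l : ℕ+) : BRel (ghost bXf k * ghost bXf l) (ghost bXf l * ghost bXf k)
  | yy (k l : ℕ+) : BRel (ghost bYf k * ghost bYf l) (ghost bYf l * ghost bYf k)
  | yx (k l : ℕ+) : BRel (ghost bYf l * ghost bXf k)
      (ghost bXf k * ghost bYf l + if k = l then ((k : ℕ) : FreeAlgebra ℚ (ℕ+ ⊕ ℕ+)) else 0)

/-- The universal algebra `B(ℚ)`. -/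
abbrev BQ : Type := RingQuot BRel

/-- The generator `x_d` of `B(ℚ)`. -/
def bx (d : ℕ+) : BQ := RingQuot.mkAlgHom ℚ BRel (bXf d)

/-- The generator `y_e` of `B(ℚ)`. -/
def by' (e : ℕ+) : BQ := RingQuot.mkAlgHom ℚ BRel (bYf e)

/-- `c` is a family of polynomials `c_{m,n}` as in the paper: `c m n` is an integral
polynomial in the variables `X_d` (`d` a proper divisor of `m`) and `Y_e` (`e` a proper
divisor of `n`) such that `[y_n, x_m] = c_{m,n}(x, y)` holds in `B(ℚ)`. -/
def IsCFamily (c : ℕ+ → ℕ+ → MvPolynomial (ℕ+ ⊕ₗ ℕ+) ℤ) : Prop :=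
  ∀ m n : ℕ+,
    (∀ v ∈ (c m n).vars,
      (∃ d : ℕ+, (d : ℕ) ∣ (m : ℕ) ∧ d ≠ m ∧ ofLex v = Sum.inl d) ∨
      (∃ e : ℕ+, (e : ℕ) ∣ (n : ℕ) ∧ e ≠ n ∧ ofLex v = Sum.inr e)) ∧
    cEval bx by' (c m n) = by' n * bx m - bx m * by' n


/-- `p ^ i` as a positive natural number. -/
def ppow (p i : ℕ) : ℕ+ := (p ^ i).toPNat'

/-- Substitution of the generators `x_0, …, x_{m-1}` for the variables `X_{p^0}, …, X_{p^{m-1}}`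
(the variable `X_{p^r}` is sent to `x_r`). -/
def sxm (R : Type*) [CommRing R] (p m n : ℕ) : ℕ+ → FreeAlgebra R (Fin m ⊕ Fin n) :=
  fun d => if h : padicValNat p (d : ℕ) < m
    then FreeAlgebra.ι R (Sum.inl ⟨padicValNat p (d : ℕ), h⟩) else 0

/-- Substitution of the generators `y_0, …, y_{n-1}` for the variables `Y_{p^0}, …, Y_{p^{n-1}}`
(the variable `Y_{p^s}` is sent to `y_s`). -/
def syn (R : Type*) [CommRing R] (p m n : ℕ) : ℕ+ → FreeAlgebra R (Fin m ⊕ Fin n) :=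
  fun e => if h : padicValNat p (e : ℕ) < n
    then FreeAlgebra.ι R (Sum.inr ⟨padicValNat p (e : ℕ), h⟩) else 0

/-- The defining relations of the truncated `p`-typical algebra `B_{m,n}(R)`:
`[x_i, x_{i'}] = 0`, `[y_j, y_{j'}] = 0` and
`[y_j, x_i] = c_{p^i, p^j}(x_0, …, x_{i-1}, y_0, …, y_{j-1})`. -/
inductive BmnRel (R : Type*) [CommRing R] (p : ℕ)
    (c : ℕ+ → ℕ+ → MvPolynomial (ℕ+ ⊕ₗ ℕ+) ℤ) (m n : ℕ) :
    FreeAlgebra R (Fin m ⊕ Fin n) → FreeAlgebra R (Fin m ⊕ Fin n) → Prop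
  | xx (i i' : Fin m) : BmnRel R p c m n
      (FreeAlgebra.ι R (Sum.inl i) * FreeAlgebra.ι R (Sum.inl i'))
      (FreeAlgebra.ι R (Sum.inl i') * FreeAlgebra.ι R (Sum.inl i))
  | yy (j j' : Fin n) : BmnRel R p c m n
      (FreeAlgebra.ι R (Sum.inr j) * FreeAlgebra.ι R (Sum.inr j'))
      (FreeAlgebra.ι R (Sum.inr j') * FreeAlgebra.ι R (Sum.inr j))
  | yx (i : Fin m) (j : Fin n) : BmnRel R p c m n
      (FreeAlgebra.ι R (Sum.inr j) * FreeAlgebra.ι R (Sum.inl i))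
      (FreeAlgebra.ι R (Sum.inl i) * FreeAlgebra.ι R (Sum.inr j) +
        cEval (sxm R p m n) (syn R p m n) (c (ppow p (i : ℕ)) (ppow p (j : ℕ))))

/-- The truncated `p`-typical algebra `B_{m,n}(R)`. -/
abbrev Bmn (R : Type*) [CommRing R] (p : ℕ) (c : ℕ+ → ℕ+ → MvPolynomial (ℕ+ ⊕ₗ ℕ+) ℤ)
    (m n : ℕ) : Type _ := RingQuot (BmnRel R p c m n)

/-- The generator `x_i` of `B_{m,n}(R)`. -/
def gx (R : Type*) [CommRing R] (p : ℕ) (c : ℕ+ → ℕ+ → MvPolynomial (ℕ+ ⊕ₗ ℕ+) ℤ)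
    (m n : ℕ) (i : Fin m) : Bmn R p c m n :=
  RingQuot.mkAlgHom R (BmnRel R p c m n) (FreeAlgebra.ι R (Sum.inl i))

/-- The generator `y_j` of `B_{m,n}(R)`. -/
def gy (R : Type*) [CommRing R] (p : ℕ) (c : ℕ+ → ℕ+ → MvPolynomial (ℕ+ ⊕ₗ ℕ+) ℤ)
    (m n : ℕ) (j : Fin n) : Bmn R p c m n :=
  RingQuot.mkAlgHom R (BmnRel R p c m n) (FreeAlgebra.ι R (Sum.inr j))
/-- The relations `x_i^{p^n} = a_i`, `y_j^{p^m} = b_j` defining `A_{((a,b))_{p^m,p^n}}`. -/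
inductive ASRel (K : Type*) [Field K] (p : ℕ) [Fact p.Prime]
    (c : ℕ+ → ℕ+ → MvPolynomial (ℕ+ ⊕ₗ ℕ+) ℤ) (m n : ℕ)
    (a : TruncatedWittVector p m K) (b : TruncatedWittVector p n K) :
    Bmn K p c m n → Bmn K p c m n → Prop
  | xa (i : Fin m) : ASRel K p c m n a b
      (gx K p c m n i ^ p ^ n) (algebraMap K (Bmn K p c m n) (a.coeff i))
  | yb (j : Fin n) : ASRel K p c m n a b
      (gy K p c m n j ^ p ^ m) (algebraMap K (Bmn K p c m n) (b.coeff j))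

/-- The central simple algebra `A_{((a,b))_{p^m,p^n}}`. -/
abbrev Asymb (K : Type*) [Field K] (p : ℕ) [Fact p.Prime]
    (c : ℕ+ → ℕ+ → MvPolynomial (ℕ+ ⊕ₗ ℕ+) ℤ) (m n : ℕ)
    (a : TruncatedWittVector p m K) (b : TruncatedWittVector p n K) : Type _ :=
  RingQuot (ASRel K p c m n a b)

/-- The image of the generator `x_i` in `A_{((a,b))_{p^m,p^n}}`. -/
def aX (K : Type*) [Field K] (p : ℕ) [Fact p.Prime]
    (c : ℕ+ → ℕ+ → MvPolynomial (ℕ+ ⊕ₗ ℕ+) ℤ) (m n : ℕ)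
    (a : TruncatedWittVector p m K) (b : TruncatedWittVector p n K) (i : Fin m) :
    Asymb K p c m n a b :=
  RingQuot.mkAlgHom K (ASRel K p c m n a b) (gx K p c m n i)

/-- The image of the generator `y_j` in `A_{((a,b))_{p^m,p^n}}`. -/
def aY (K : Type*) [Field K] (p : ℕ) [Fact p.Prime]
    (c : ℕ+ → ℕ+ → MvPolynomial (ℕ+ ⊕ₗ ℕ+) ℤ) (m n : ℕ)
    (a : TruncatedWittVector p m K) (b : TruncatedWittVector p n K) (j : Fin n) :
    Asymb K p c m n a b :=
  RingQuot.mkAlgHom K (ASRel K p c m n a b) (gy K p c m n j)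

/-- Two `K`-algebras are Brauer equivalent if they become isomorphic after tensoring with
matrix algebras, i.e. `M_r(A) ≅ M_s(B)` for some `r, s ≥ 1`. -/
def BrauerEquiv (K : Type*) [Field K] (A B : Type*) [Ring A] [Algebra K A]
    [Ring B] [Algebra K B] : Prop :=
  ∃ r s : ℕ, 0 < r ∧ 0 < s ∧
    Nonempty (Matrix (Fin r) (Fin r) A ≃ₐ[K] Matrix (Fin s) (Fin s) B)


section DigitTower

variable {K A : Type*} [Field K] [Ring A] [Algebra K A]

/-- The map `(c_e)_{e < p} ↦ ∑ c_e g ^ e` with coefficients in a subspace `D`. -/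
def digitMap (p : ℕ) (D : Submodule K A) (g : A) : (Fin p → D) →ₗ[K] A :=
  ∑ e : Fin p, (LinearMap.mulRight K (g ^ (e : ℕ)) ∘ₗ D.subtype) ∘ₗ LinearMap.proj e

theorem digitMap_apply (p : ℕ) (D : Submodule K A) (g : A) (c : Fin p → D) :
    digitMap p D g c = ∑ e : Fin p, (c e : A) * g ^ (e : ℕ) := by
  simp [digitMap]

theorem mem_range_digitMap {p : ℕ} {D : Submodule K A} {g v : A} :
    v ∈ LinearMap.range (digitMap p D g) ↔
      ∃ c : ℕ → A, (∀ e, c e ∈ D) ∧ v = ∑ e ∈ Finset.range p, c e * g ^ e := by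
  constructor
  · rintro ⟨c, rfl⟩
    refine ⟨fun e => if h : e < p then c ⟨e, h⟩ else 0, fun e => ?_, ?_⟩
    · dsimp only
      split_ifs
      exacts [(c _).2, D.zero_mem]
    · rw [digitMap_apply, Finset.sum_range]
      simp
  · rintro ⟨c, hc, rfl⟩
    refine ⟨fun e => ⟨c e, hc e⟩, ?_⟩
    rw [digitMap_apply, Finset.sum_range]

theorem mul_pow_mem_range_digitMap {p : ℕ} {D : Submodule K A} {g d : A} (hd : d ∈ D) {e : ℕ}
    (he : e < p) : d * g ^ e ∈ LinearMap.range (digitMap p D g) := by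
  refine mem_range_digitMap.2 ⟨fun i => if i = e then d else 0, fun i => ?_, ?_⟩
  · dsimp only
    split_ifs
    exacts [hd, D.zero_mem]
  · simp [he]

theorem range_digitMap_le {p : ℕ} {D Q : Submodule K A} {g : A}
    (h : ∀ d ∈ D, ∀ e < p, d * g ^ e ∈ Q) : LinearMap.range (digitMap p D g) ≤ Q := by
  intro v hv
  obtain ⟨c, hc, rfl⟩ := mem_range_digitMap.1 hv
  exact Q.sum_mem fun e he => h _ (hc e) e (Finset.mem_range.1 he)

/-- The increasing sequence of subspaces obtained from `D` by successively adjoining the powers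
of `g 0, g 1, …` with exponents `< p`. -/
def digitTower (p : ℕ) (D : Submodule K A) (g : ℕ → A) : ℕ → Submodule K A
  | 0 => D
  | s + 1 => LinearMap.range (digitMap p (digitTower p D g s) (g s))

theorem digitTower_add (p : ℕ) (D : Submodule K A) (g : ℕ → A) (r s : ℕ) :
    digitTower p D g (r + s) = digitTower p (digitTower p D g r) (fun i => g (r + i)) s := by
  induction s with
  | zero => rfl
  | succ s ih => rw [← add_assoc, digitTower, digitTower, ih]

theorem digitTower_congr (p : ℕ) (D : Submodule K A) {g g' : ℕ → A} {s : ℕ}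
    (h : ∀ i < s, g i = g' i) : digitTower p D g s = digitTower p D g' s := by
  induction s with
  | zero => rfl
  | succ s ih =>
    rw [digitTower, digitTower, ih fun i hi => h i (by omega), h s (by omega)]

theorem map_digitTower {A' : Type*} [Ring A'] [Algebra K A'] (f : A →ₐ[K] A') (p : ℕ)
    (D : Submodule K A) (g : ℕ → A) (s : ℕ) :
    (digitTower p D g s).map f.toLinearMap =
      digitTower p (D.map f.toLinearMap) (fun i => f (g i)) s := by
  induction s with
  | zero => rfl
  | succ s ih =>
    rw [digitTower, digitTower, ← ih]
    apply le_antisymm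
    · rw [Submodule.map_le_iff_le_comap]
      refine range_digitMap_le fun d hd e he => ?_
      rw [Submodule.mem_comap, AlgHom.toLinearMap_apply, map_mul, map_pow]
      exact mul_pow_mem_range_digitMap (Submodule.mem_map_of_mem hd) he
    · refine range_digitMap_le fun d hd e he => ?_
      obtain ⟨d, hd, rfl⟩ := hd
      refine ⟨d * g s ^ e, mul_pow_mem_range_digitMap hd he, ?_⟩
      simp

theorem finite_digitTower (p : ℕ) (D : Submodule K A) [Module.Finite K D] (g : ℕ → A) (s : ℕ) :
    Module.Finite K (digitTower p D g s) := by
  induction s with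
  | zero => assumption
  | succ s ih => rw [digitTower]; infer_instance

theorem finrank_digitTower_le (p : ℕ) (D : Submodule K A) [Module.Finite K D] (g : ℕ → A)
    (s : ℕ) : Module.finrank K (digitTower p D g s) ≤ p ^ s * Module.finrank K D := by
  induction s with
  | zero => rw [pow_zero, one_mul]; exact le_rfl
  | succ s ih =>
    have := finite_digitTower p D g s
    rw [digitTower]
    refine (LinearMap.finrank_range_le _).trans ?_
    rw [Module.finrank_pi_fintype]
    simp only [Finset.sum_const, Finset.card_univ, Fintype.card_fin, smul_eq_mul]
    rw [pow_succ', mul_assoc]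
    exact Nat.mul_le_mul_left _ ih

theorem mul_pow_of_commutator_eq_one {g gs : A} (h : gs * g - g * gs = 1) (e : ℕ) :
    gs * g ^ (e + 1) = g ^ (e + 1) * gs + ((e + 1 : ℕ) : A) * g ^ e := by
  have h' : gs * g = g * gs + 1 := by rw [← h]; abel
  induction e with
  | zero => simpa using h'
  | succ e ih =>
    rw [pow_succ, ← mul_assoc, ih, add_mul, mul_assoc _ gs, h', mul_add, mul_one, ← mul_assoc,
      ← pow_succ, mul_assoc _ (g ^ e) g, ← pow_succ]
    push_cast
    noncomm_ring

theorem commutator_sum {g gs : A} (h : gs * g - g * gs = 1) {c : ℕ → A}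
    (hc : ∀ e, Commute gs (c e)) (d : ℕ) :
    gs * (∑ e ∈ Finset.range (d + 1), c e * g ^ e) -
        (∑ e ∈ Finset.range (d + 1), c e * g ^ e) * gs =
      ∑ e ∈ Finset.range d, (((e + 1 : ℕ) : K) • c (e + 1)) * g ^ e := by
  rw [Finset.mul_sum, Finset.sum_mul, ← Finset.sum_sub_distrib, Finset.sum_range_succ']
  simp only [pow_zero, mul_one, (hc 0).eq, sub_self, add_zero]
  refine Finset.sum_congr rfl fun e _ => ?_
  rw [← mul_assoc, (hc (e + 1)).eq, mul_assoc, mul_pow_of_commutator_eq_one h, mul_add,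
    ← mul_assoc, add_sub_cancel_left, ← mul_assoc, smul_mul_assoc, Nat.cast_smul_eq_nsmul,
    nsmul_eq_mul, ← mul_assoc, Nat.cast_comm]

variable (p : ℕ) [Fact p.Prime] [CharP K p]

omit [Fact p.Prime] in
include K in
theorem exists_coeff_mem {g gs : A} (h : gs * g - g * gs = 1) (I : Submodule K A)
    (hI : ∀ v ∈ I, gs * v - v * gs ∈ I) (d : ℕ) (hd : d ≤ p) (c : ℕ → A)
    (hc : ∀ e, Commute gs (c e)) (hv : ∑ e ∈ Finset.range d, c e * g ^ e ∈ I)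
    (hne : ∃ e < d, c e ≠ 0) : ∃ e < d, c e ≠ 0 ∧ c e ∈ I := by
  induction d generalizing c with
  | zero => simp at hne
  | succ d ih =>
    by_cases hex : ∃ e < d, c (e + 1) ≠ 0
    · have hK : ∀ e < d, ((e + 1 : ℕ) : K) ≠ 0 := fun e he h0 => by
        rw [CharP.cast_eq_zero_iff K p] at h0
        exact absurd (Nat.le_of_dvd (by omega) h0) (by omega)
      obtain ⟨e, he, hne'⟩ := hex
      have := hI _ hv
      rw [commutator_sum (K := K) h hc] at this
      obtain ⟨e', he', h1, h2⟩ := ih (by omega) _ (fun e => (hc (e + 1)).smul_right _) this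
        ⟨e, he, smul_ne_zero (hK e he) hne'⟩
      exact ⟨e' + 1, by omega, fun h0 => h1 (by rw [h0, smul_zero]),
        (Submodule.smul_mem_iff _ (hK e' he')).1 h2⟩
    · push Not at hex
      rw [Finset.sum_range_succ', Finset.sum_eq_zero (fun e he => by
        rw [hex e (Finset.mem_range.1 he), zero_mul]), zero_add, pow_zero, mul_one] at hv
      obtain ⟨e, he, hne⟩ := hne
      cases e with
      | zero => exact ⟨0, he, hne, hv⟩
      | succ e => exact absurd (hex e (by omega)) hne

section Dual

variable {g gs : ℕ → A} {N : ℕ} (h1 : ∀ s < N, gs s * g s - g s * gs s = 1)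
  (h0 : ∀ s < N, ∀ i < s, Commute (gs s) (g i))

omit [Fact p.Prime] [CharP K p] in
include h0 in
theorem commute_of_mem_digitTower {s t : ℕ} (hst : s ≤ t) (ht : t < N) {v : A}
    (hv : v ∈ digitTower p (1 : Submodule K A) g s) : Commute (gs t) v := by
  induction s generalizing v with
  | zero =>
    obtain ⟨k, rfl⟩ := Submodule.mem_one.1 hv
    exact (Algebra.commutes k _).symm
  | succ s ih =>
    obtain ⟨c, hc, rfl⟩ := mem_range_digitMap.1 hv
    exact Commute.sum_right _ _ _ fun e _ =>
      (ih (by omega) (hc e)).mul_right ((h0 t ht s (by omega)).pow_right e)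

include h1 h0 in
omit [Fact p.Prime] in
theorem exists_algebraMap_mem (I : Submodule K A) (hI : ∀ s < N, ∀ v ∈ I, gs s * v - v * gs s ∈ I)
    {s : ℕ} (hs : s ≤ N) {v : A} (hv : v ∈ digitTower p (1 : Submodule K A) g s) (hvI : v ∈ I)
    (hv0 : v ≠ 0) : ∃ k : K, k ≠ 0 ∧ algebraMap K A k ∈ I := by
  induction s generalizing v with
  | zero =>
    obtain ⟨k, rfl⟩ := Submodule.mem_one.1 hv
    exact ⟨k, fun h => hv0 (by rw [h, map_zero]), hvI⟩
  | succ s ih =>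
    obtain ⟨c, hc, rfl⟩ := mem_range_digitMap.1 hv
    obtain ⟨e, _, hne, heI⟩ := exists_coeff_mem p (h1 s (by omega)) I (hI s (by omega)) p le_rfl c
      (fun e => commute_of_mem_digitTower p h0 le_rfl (by omega) (hc e)) hvI (by
        by_contra! hcon
        exact hv0 (Finset.sum_eq_zero fun e he => by
          rw [hcon e (Finset.mem_range.1 he), zero_mul]))
    exact ih (by omega) (hc e) heI hne

include h1 h0 in
theorem mem_one_of_commute {s : ℕ} (hs : s ≤ N) {v : A}
    (hv : v ∈ digitTower p (1 : Submodule K A) g s) (hcomm : ∀ t < N, Commute (gs t) v) :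
    v ∈ (1 : Submodule K A) := by
  induction s generalizing v with
  | zero => exact hv
  | succ s ih =>
    obtain ⟨c, hc, rfl⟩ := mem_range_digitMap.1 hv
    obtain ⟨q, rfl⟩ : ∃ q, p = q + 1 := ⟨p - 1, by have := (Fact.out : p.Prime).pos; omega⟩
    have hK : ∀ e < q, ((e + 1 : ℕ) : K) ≠ 0 := fun e he h0 => by
      rw [CharP.cast_eq_zero_iff K (q + 1)] at h0
      exact absurd (Nat.le_of_dvd (by omega) h0) (by omega)
    have hcc : ∀ e, Commute (gs s) (c e) := fun e =>
      commute_of_mem_digitTower _ h0 le_rfl (by omega) (hc e)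
    have hz := commutator_sum (K := K) (h1 s (by omega)) hcc q
    rw [sub_eq_zero.2 (hcomm s (by omega)).eq] at hz
    have hall : ∀ e < q, c (e + 1) = 0 := by
      by_contra! hcon
      obtain ⟨e, he, hne⟩ := hcon
      obtain ⟨e', he', hne', hmem⟩ := exists_coeff_mem (q + 1) (h1 s (by omega)) (⊥ : Submodule K A)
        (by simp) q (by omega) _ (fun e => (hcc (e + 1)).smul_right ((e + 1 : ℕ) : K))
        (by rw [← hz]; simp) ⟨e, he, smul_ne_zero (hK e he) hne⟩
      exact hne' hmem
    have hsum : ∑ e ∈ Finset.range (q + 1), c e * g s ^ e = c 0 := by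
      rw [Finset.sum_range_succ', Finset.sum_eq_zero (fun e he => by
        rw [hall e (Finset.mem_range.1 he), zero_mul]), zero_add, pow_zero, mul_one]
    rw [hsum] at hcomm ⊢
    exact ih (by omega) (hc 0) hcomm

include h1 h0 in
omit [Fact p.Prime] in
theorem finrank_digitTower [Nontrivial A] {s : ℕ} (hs : s ≤ N) :
    Module.finrank K (digitTower p (1 : Submodule K A) g s) = p ^ s := by
  induction s with
  | zero =>
    rw [digitTower, pow_zero, Submodule.one_eq_span]
    exact finrank_span_singleton one_ne_zero
  | succ s ih =>
    have : Module.Finite K (1 : Submodule K A) := by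
      rw [Submodule.one_eq_span]; infer_instance
    have := finite_digitTower p (1 : Submodule K A) g s
    rw [digitTower, LinearMap.finrank_range_of_inj, Module.finrank_pi_fintype]
    · simp [ih (by omega), pow_succ']
    · rw [← LinearMap.ker_eq_bot, LinearMap.ker_eq_bot']
      intro c hc
      by_contra hne
      obtain ⟨e₀, he₀⟩ := Function.ne_iff.1 hne
      rw [digitMap_apply] at hc
      obtain ⟨e, -, hne', hmem⟩ := exists_coeff_mem p (h1 s (by omega)) (⊥ : Submodule K A) (by simp)
        p le_rfl (fun e => if h : e < p then (c ⟨e, h⟩ : A) else 0) (fun e => by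
          split_ifs
          · exact commute_of_mem_digitTower p h0 le_rfl (by omega) (c _).2
          · exact Commute.zero_right _)
        (by rw [Finset.sum_range]; simpa using hc)
        ⟨e₀, e₀.2, by simpa using he₀⟩
      exact hne' hmem

end Dual

end DigitTower

section PTypical

variable {G : Type*} [Ring G] (p : ℕ)

/-- The `p`-typical ghost components `∑_{s ≤ i} p ^ s * x_s ^ (p ^ (i - s))`. -/
def pGhost (x : ℕ → G) (i : ℕ) : G :=
  ∑ s ∈ Finset.range (i + 1), ((p ^ s : ℕ) : G) * x s ^ p ^ (i - s)

theorem pGhost_eq (x : ℕ → G) (i : ℕ) :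
    pGhost p x i = (∑ s ∈ Finset.range i, ((p ^ s : ℕ) : G) * x s ^ p ^ (i - s)) +
      ((p ^ i : ℕ) : G) * x i := by
  rw [pGhost, Finset.sum_range_succ, Nat.sub_self, pow_zero, pow_one]

theorem pGhost_add (x : ℕ → G) (k j : ℕ) :
    pGhost p x (k + j) = (∑ s ∈ Finset.range k, ((p ^ s : ℕ) : G) * x s ^ p ^ (k + j - s)) +
      ((p ^ k : ℕ) : G) * pGhost p (fun i => x (k + i)) j := by
  rw [pGhost, add_assoc, Finset.sum_range_add, pGhost, Finset.mul_sum]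
  congr 1
  refine Finset.sum_congr rfl fun s hs => ?_
  rw [← mul_assoc, ← Nat.cast_mul, ← pow_add, Nat.add_sub_add_left]

theorem map_pGhost_of_cast_eq_zero {A : Type*} [Ring A] (f : G →+* A) (hp : ((p : ℕ) : A) = 0)
    (x : ℕ → G) (i : ℕ) : f (pGhost p x i) = f (x 0) ^ p ^ i := by
  rw [pGhost, Finset.sum_range_succ', map_add, map_sum, Finset.sum_eq_zero fun s _ => ?_]
  · simp
  · rw [map_mul, map_natCast, Nat.cast_pow, hp, zero_pow (by omega), zero_mul]

open scoped IsMulCommutative in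
/-- A commuting family can be substituted into integral polynomials. -/
theorem exists_ringHom_of_commute {x : ℕ → G} (hx : ∀ i j, Commute (x i) (x j)) :
    ∃ Φ : MvPolynomial ℕ ℤ →+* G, ∀ i, Φ (MvPolynomial.X i) = x i := by
  have := Algebra.isMulCommutative_adjoin ℤ (s := Set.range x) (by
    rintro _ ⟨i, rfl⟩ _ ⟨j, rfl⟩
    exact hx i j)
  let x' : ℕ → Algebra.adjoin ℤ (Set.range x) := fun i =>
    ⟨x i, Algebra.subset_adjoin ⟨i, rfl⟩⟩
  exact ⟨(Algebra.adjoin ℤ (Set.range x)).val.toRingHom.comp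
    (MvPolynomial.eval₂Hom (Int.castRingHom _) x'), fun i => by simp [x']⟩

variable [hp : Fact p.Prime]

/-- The lift of Frobenius on Witt vectors: it shifts the ghost components. -/
theorem exists_frobenius_shift {x : ℕ → G} (hx : ∀ i j, Commute (x i) (x j)) :
    ∃ x' : ℕ → G, (∀ i, pGhost p x' i = pGhost p x (i + 1)) ∧
      (∀ i, ∃ r, x' i = x i ^ p + (p : G) * r) ∧ ∀ i j, Commute (x' i) (x' j) := by
  obtain ⟨Φ, hΦ⟩ := exists_ringHom_of_commute hx
  have hw : ∀ (q : ℕ → MvPolynomial ℕ ℤ) (n : ℕ),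
      Φ (MvPolynomial.bind₁ q (wittPolynomial p ℤ n)) = pGhost p (fun i => Φ (q i)) n := by
    intro q n
    rw [wittPolynomial_eq_sum_C_mul_X_pow, pGhost, map_sum, map_sum]
    refine Finset.sum_congr rfl fun s _ => ?_
    simp
  refine ⟨fun i => Φ (WittVector.frobeniusPoly p i), fun i => ?_, fun i => ?_, fun i j => ?_⟩
  · have := hw MvPolynomial.X (i + 1)
    rw [MvPolynomial.bind₁_X_left, AlgHom.id_apply] at this
    rw [← hw, WittVector.bind₁_frobeniusPoly_wittPolynomial, this]
    simp only [hΦ]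
  · obtain ⟨r, hr⟩ : MvPolynomial.C (p : ℤ) ∣
        WittVector.frobeniusPoly p i - MvPolynomial.X i ^ p := by
      rw [MvPolynomial.C_dvd_iff_zmod, map_sub, WittVector.frobeniusPoly_zmod]
      simp
    refine ⟨Φ r, ?_⟩
    rw [sub_eq_iff_eq_add'] at hr
    dsimp only
    rw [hr, map_add, map_pow, hΦ, map_mul]
    simp
  · rw [Commute, SemiconjBy, ← map_mul, mul_comm, map_mul]

theorem exists_iterate_frobenius_shift {x : ℕ → G} (hx : ∀ i j, Commute (x i) (x j)) (k : ℕ) :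
    ∃ x' : ℕ → G, (∀ i, pGhost p x' i = pGhost p x (k + i)) ∧
      (∀ {A : Type*} [Ring A] (f : G →+* A), ((p : ℕ) : A) = 0 → ∀ i, f (x' i) = f (x i) ^ p ^ k) ∧
      ∀ i j, Commute (x' i) (x' j) := by
  induction k with
  | zero => exact ⟨x, fun i => by rw [zero_add], fun f _ i => by simp, hx⟩
  | succ k ih =>
    obtain ⟨u, hu, hfu, hcu⟩ := ih
    obtain ⟨v, hv, hfv, hcv⟩ := exists_frobenius_shift p hcu
    refine ⟨v, fun i => by rw [hv, hu]; congr 1; omega, fun f hf i => ?_, hcv⟩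
    obtain ⟨r, hr⟩ := hfv i
    rw [hr, map_add, map_mul, map_natCast, hf, zero_mul, add_zero, map_pow, hfu f hf, pow_succ,
      pow_mul]

variable {p} (htf : ∀ g : G, (p : G) * g = 0 → g = 0)

omit hp in
include htf in
theorem eq_zero_of_pow_mul (k : ℕ) (g : G) (h : ((p ^ k : ℕ) : G) * g = 0) : g = 0 := by
  induction k with
  | zero => simpa using h
  | succ k ih =>
    refine ih (htf _ ?_)
    rwa [← mul_assoc, ← Nat.cast_mul, ← pow_succ']

omit hp in
include htf in
theorem commute_of_commute_mul (k : ℕ) {z g : G} (h : Commute z (((p ^ k : ℕ) : G) * g)) :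
    Commute z g := by
  refine sub_eq_zero.1 (eq_zero_of_pow_mul htf k _ ?_)
  rw [mul_sub, ← mul_assoc, ← mul_assoc, Nat.cast_comm, mul_assoc, h.eq]
  simp [mul_assoc]

omit hp in
include htf in
theorem commute_of_commute_pGhost {z : G} {u : ℕ → G} {r : ℕ}
    (h : ∀ i < r, Commute z (pGhost p u i)) : ∀ i < r, Commute z (u i) := by
  intro i
  induction i using Nat.strong_induction_on with
  | _ i ih =>
    intro hi
    refine commute_of_commute_mul htf i ?_
    rw [← sub_eq_iff_eq_add'.2 (pGhost_eq p u i)]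
    refine (h i hi).sub_right (Commute.sum_right _ _ _ fun s hs => ?_)
    have hs := Finset.mem_range.1 hs
    exact (Nat.cast_commute _ z).symm.mul_right ((ih s hs (by omega)).pow_right _)

variable {x y : ℕ → G} (hx : ∀ i j, Commute (x i) (x j)) (hy : ∀ i j, Commute (y i) (y j))
  (hne : ∀ i j, i ≠ j → Commute (pGhost p y j) (pGhost p x i))
  (heq : ∀ i, pGhost p y i * pGhost p x i - pGhost p x i * pGhost p y i = ((p ^ i : ℕ) : G))
  {A : Type*} [Ring A] (f : G →+* A) (hpA : ((p : ℕ) : A) = 0)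

omit hp in
include htf hne in
theorem commute_of_pGhost_shift {x' : ℕ → G} {k : ℕ}
    (hx' : ∀ i, pGhost p x' i = pGhost p x (k + i)) {s : ℕ} (hs : s < k) (i : ℕ) :
    Commute (y s) (x' i) := by
  refine commute_of_commute_pGhost htf (r := i + 1) (fun i' _ => ?_) i (by omega)
  rw [hx']
  exact (commute_of_commute_pGhost htf (r := k)
    (fun j hj => (hne (k + i') j (by omega)).symm) s hs).symm

include htf hx hne hpA in
theorem map_commute_pow {s k : ℕ} (hs : s < k) (i : ℕ) :
    Commute (f (y s)) (f (x i) ^ p ^ k) := by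
  obtain ⟨x', h1, h2, -⟩ := exists_iterate_frobenius_shift p hx k
  rw [← h2 f hpA]
  exact (commute_of_pGhost_shift htf hne h1 hs i).map f

include htf hx hne heq hpA in
theorem map_commutator_pow (k l : ℕ) :
    f (y k) ^ p ^ l * f (x l) ^ p ^ k - f (x l) ^ p ^ k * f (y k) ^ p ^ l = 1 := by
  obtain ⟨x', h1, h2, -⟩ := exists_iterate_frobenius_shift p hx k
  have hcomm : ∀ s < k, ∀ i, Commute (y s) (x' i) := fun s hs i =>
    commute_of_pGhost_shift htf hne h1 hs i
  set y' : ℕ → G := fun j => y (k + j)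
  have hcg : ∀ (e : ℕ → ℕ) (i : ℕ), Commute
      (∑ s ∈ Finset.range k, ((p ^ s : ℕ) : G) * y s ^ e s) (pGhost p x' i) := by
    intro e i
    refine Commute.sum_left _ _ _ fun s hs => (Nat.cast_commute _ _).mul_left ?_
    refine Commute.pow_left (Commute.sum_right _ _ _ fun i' _ => ?_) _
    exact (Nat.cast_commute _ _).symm.mul_right
      ((hcomm s (Finset.mem_range.1 hs) i').pow_right _)
  have hkey : ∀ i j, ((p ^ k : ℕ) : G) *
      (pGhost p y' j * pGhost p x' i - pGhost p x' i * pGhost p y' j) =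
      pGhost p y (k + j) * pGhost p x (k + i) - pGhost p x (k + i) * pGhost p y (k + j) := by
    intro i j
    rw [← h1, pGhost_add p y, add_mul, mul_add, (hcg _ i).eq, add_sub_add_left_eq_sub, mul_sub,
      mul_assoc, ← mul_assoc (pGhost p x' i), ← Nat.cast_comm, mul_assoc]
  have hne' : ∀ i < l, Commute (pGhost p y' l) (pGhost p x' i) := fun i hi => by
    refine sub_eq_zero.1 (eq_zero_of_pow_mul htf k _ ?_)
    rw [hkey, sub_eq_zero]
    exact (hne _ _ (by omega)).eq
  have heq' : pGhost p y' l * pGhost p x' l - pGhost p x' l * pGhost p y' l =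
      ((p ^ l : ℕ) : G) := by
    refine sub_eq_zero.1 (eq_zero_of_pow_mul htf k _ ?_)
    rw [mul_sub, hkey, heq, ← Nat.cast_mul, ← pow_add, sub_self]
  have hone : pGhost p y' l * x' l - x' l * pGhost p y' l = 1 := by
    have hlow : Commute (pGhost p y' l)
        (∑ s ∈ Finset.range l, ((p ^ s : ℕ) : G) * x' s ^ p ^ (l - s)) :=
      Commute.sum_right _ _ _ fun s hs => (Nat.cast_commute _ _).symm.mul_right
        ((commute_of_commute_pGhost htf hne' s (Finset.mem_range.1 hs)).pow_right _)
    have h3 := heq'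
    rw [pGhost_eq p x' l, mul_add, add_mul, hlow.eq, add_sub_add_left_eq_sub, ← mul_assoc,
      ← Nat.cast_comm, mul_assoc, mul_assoc] at h3
    refine sub_eq_zero.1 (eq_zero_of_pow_mul htf l _ ?_)
    rw [mul_sub, mul_one, mul_sub, sub_eq_zero]
    exact h3
  have := congrArg f hone
  rwa [map_sub, map_mul, map_mul, map_pGhost_of_cast_eq_zero p f hpA, h2 f hpA, map_one] at this

end PTypical

section Spanning

variable {K A : Type*} [Field K] [Ring A] [Algebra K A]

theorem mul_mem_of_mem_adjoin {S : Set A} {Q : Submodule K A} (h : ∀ v ∈ Q, ∀ g ∈ S, v * g ∈ Q)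
    {v a : A} (hv : v ∈ Q) (ha : a ∈ Algebra.adjoin K S) : v * a ∈ Q := by
  induction ha using Algebra.adjoin_induction generalizing v with
  | mem g hg => exact h v hv g hg
  | algebraMap k =>
    rw [← Algebra.commutes, ← Algebra.smul_def]
    exact Q.smul_mem k hv
  | add a b _ _ ha hb => rw [mul_add]; exact Q.add_mem (ha hv) (hb hv)
  | mul a b _ _ ha hb => rw [← mul_assoc]; exact hb (ha hv)

theorem mem_adjoin_mul_mem {S : Set A} {Q : Submodule K A} (h : ∀ v ∈ Q, ∀ g ∈ S, g * v ∈ Q)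
    {v a : A} (hv : v ∈ Q) (ha : a ∈ Algebra.adjoin K S) : a * v ∈ Q := by
  induction ha using Algebra.adjoin_induction generalizing v with
  | mem g hg => exact h v hv g hg
  | algebraMap k =>
    rw [← Algebra.smul_def]
    exact Q.smul_mem k hv
  | add a b _ _ ha hb => rw [add_mul]; exact Q.add_mem (ha hv) (hb hv)
  | mul a b _ _ ha hb => rw [mul_assoc]; exact ha (hb hv)

theorem mul_mem_digitTower {p : ℕ} (hp : 0 < p) (D : Submodule K A) {h : ℕ → A} {r : ℕ}
    (hc : ∀ i < r, ∀ j < r, Commute (h i) (h j))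
    (hpow : ∀ s < r, h s ^ p ∈ Algebra.adjoin K (h '' Set.Iio s)) {s : ℕ} (hs : s ≤ r) {v a : A}
    (hv : v ∈ digitTower p D h s) (ha : a ∈ Algebra.adjoin K (h '' Set.Iio s)) :
    v * a ∈ digitTower p D h s := by
  induction s generalizing v a with
  | zero =>
    refine mul_mem_of_mem_adjoin ?_ hv ha
    rintro _ _ _ ⟨i, hi, rfl⟩
    simp at hi
  | succ s ih =>
    refine mul_mem_of_mem_adjoin ?_ hv ha
    rintro v hv _ ⟨i, hi, rfl⟩
    have hi : i < s + 1 := hi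
    obtain ⟨c, hcD, rfl⟩ := mem_range_digitMap.1 hv
    rw [Finset.sum_mul]
    refine Submodule.sum_mem _ fun e he => ?_
    have he := Finset.mem_range.1 he
    rcases Nat.lt_succ_iff_lt_or_eq.1 hi with hi | rfl
    · rw [mul_assoc, ((hc s (by omega) i (by omega)).pow_left e).eq, ← mul_assoc]
      exact mul_pow_mem_range_digitMap
        (ih (by omega) (hcD e) (Algebra.subset_adjoin ⟨i, hi, rfl⟩)) he
    · rw [mul_assoc, ← pow_succ]
      rcases Nat.lt_or_eq_of_le he with he | he
      · exact mul_pow_mem_range_digitMap (hcD e) he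
      · rw [← mul_one (c e * _), ← pow_zero (h i)]
        refine mul_pow_mem_range_digitMap (ih (by omega) (hcD e) ?_) hp
        rw [show e + 1 = p from he]
        exact hpow i (by omega)

theorem le_digitTower {p : ℕ} (hp : 0 < p) (D : Submodule K A) (h : ℕ → A) (s : ℕ) :
    D ≤ digitTower p D h s := by
  induction s with
  | zero => exact le_rfl
  | succ s ih =>
    intro v hv
    rw [← mul_one v, ← pow_zero (h s)]
    exact mul_pow_mem_range_digitMap (ih hv) hp

/-- If the commutators of the `y_j` with the `x_i` are normally ordered polynomials in the `x_i`
and in the `y_{j'}` with `j' < j`, then all polynomials in the `x_i` and `y_j` can be brought into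
normally ordered form. -/
theorem adjoin_mul_adjoin_le {S : Set A} {y : ℕ → A} {n : ℕ}
    (h : ∀ j < n, ∀ g ∈ S, y j * g - g * y j ∈
      Subalgebra.toSubmodule (Algebra.adjoin K S) *
        Subalgebra.toSubmodule (Algebra.adjoin K (y '' Set.Iio j))) {j : ℕ} (hj : j ≤ n) :
    Subalgebra.toSubmodule (Algebra.adjoin K (y '' Set.Iio j)) *
        Subalgebra.toSubmodule (Algebra.adjoin K S) ≤
      Subalgebra.toSubmodule (Algebra.adjoin K S) *
        Subalgebra.toSubmodule (Algebra.adjoin K (y '' Set.Iio j)) := by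
  induction j with
  | zero =>
    refine Submodule.mul_le.2 fun a ha b hb => mem_adjoin_mul_mem ?_ ?_ ha
    · rintro _ _ _ ⟨i, hi, rfl⟩
      simp at hi
    · rw [← mul_one b]
      exact Submodule.mul_mem_mul hb (one_mem (Algebra.adjoin K _))
  | succ j ih =>
    have ih := ih (by omega)
    set C := Algebra.adjoin K S
    set D := Algebra.adjoin K (y '' Set.Iio j)
    set D' := Algebra.adjoin K (y '' Set.Iio (j + 1))
    have hDD : D ≤ D' := Algebra.adjoin_mono (Set.image_mono (Set.Iio_subset_Iio (by omega)))
    have hCC : Subalgebra.toSubmodule C * (Subalgebra.toSubmodule C * Subalgebra.toSubmodule D) ≤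
        Subalgebra.toSubmodule C * Subalgebra.toSubmodule D := by
      rw [← mul_assoc, Subalgebra.isIdempotentElem_toSubmodule _ |>.eq]
    have hCD : Subalgebra.toSubmodule C * Subalgebra.toSubmodule D * Subalgebra.toSubmodule C ≤
        Subalgebra.toSubmodule C * Subalgebra.toSubmodule D := by
      rw [mul_assoc]
      exact (mul_le_mul_right ih _).trans hCC
    have hcomm : ∀ a ∈ C, y j * a - a * y j ∈
        Subalgebra.toSubmodule C * Subalgebra.toSubmodule D := by
      intro a ha
      induction ha using Algebra.adjoin_induction with
      | mem g hg => exact h j (by omega) g hg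
      | algebraMap k => rw [Algebra.commutes, sub_self]; exact Submodule.zero_mem _
      | add a b _ _ ha hb =>
        convert Submodule.add_mem _ ha hb using 1
        noncomm_ring
      | mul a b ha' hb' ha hb =>
        convert Submodule.add_mem _ (hCD (Submodule.mul_mem_mul ha hb'))
          (hCC (Submodule.mul_mem_mul ha' hb)) using 1
        noncomm_ring
    have hle : Subalgebra.toSubmodule C * Subalgebra.toSubmodule D ≤
        Subalgebra.toSubmodule C * Subalgebra.toSubmodule D' :=
      mul_le_mul_right (Subalgebra.toSubmodule.monotone hDD) _
    have hy : ∀ i < j + 1, ∀ a ∈ C, y i * a ∈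
        Subalgebra.toSubmodule C * Subalgebra.toSubmodule D' := by
      intro i hi a ha
      rcases Nat.lt_succ_iff_lt_or_eq.1 hi with hi | rfl
      · exact hle (ih (Submodule.mul_mem_mul (Algebra.subset_adjoin ⟨i, hi, rfl⟩) ha))
      · rw [← sub_add_cancel (y i * a) (a * y i)]
        exact Submodule.add_mem _ (hle (hcomm a ha))
          (Submodule.mul_mem_mul ha (Algebra.subset_adjoin ⟨i, hi, rfl⟩))
    refine Submodule.mul_le.2 fun a ha b hb => mem_adjoin_mul_mem ?_ ?_ ha
    · rintro v hv _ ⟨i, hi, rfl⟩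
      refine Submodule.mul_induction_on hv (fun b hb d hd => ?_) fun u v hu hv => ?_
      · have := Submodule.mul_mem_mul (hy i hi b hb) (show d ∈ Subalgebra.toSubmodule D' from hd)
        rwa [mul_assoc (Subalgebra.toSubmodule C), Subalgebra.isIdempotentElem_toSubmodule _ |>.eq, mul_assoc] at this
      · rw [mul_add]
        exact Submodule.add_mem _ hu hv
    · rw [← mul_one b]
      exact Submodule.mul_mem_mul hb (one_mem (Algebra.adjoin K _))

end Spanning

section Evaluation

variable {σ A B : Type*} [LinearOrder σ] [Ring A] [Ring B]

theorem pEval_congr {x x' : σ → A} {q : MvPolynomial σ ℤ} (h : ∀ v ∈ q.vars, x v = x' v) :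
    pEval x q = pEval x' q := by
  refine Finset.sum_congr rfl fun e he => ?_
  rw [ordProd, ordProd]
  congr 2
  refine List.map_congr_left fun v hv => ?_
  rw [h v ((MvPolynomial.mem_vars_iff_mem_support v).2 ⟨e, he, by simpa using hv⟩)]

theorem map_pEval (f : A →+* B) (x : σ → A) (q : MvPolynomial σ ℤ) :
    f (pEval x q) = pEval (fun v => f (x v)) q := by
  rw [pEval, pEval, Finset.sum, Finset.sum, map_multiset_sum, Multiset.map_map]
  congr 1
  refine Multiset.map_congr rfl fun e _ => ?_
  simp only [Function.comp_apply, map_zsmul, ordProd, map_list_prod, List.map_map]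
  congr 3
  funext v
  simp

theorem pEval_mem (S : Subring A) {x : σ → A} {q : MvPolynomial σ ℤ} (h : ∀ v ∈ q.vars, x v ∈ S) :
    pEval x q ∈ S := by
  refine S.sum_mem fun e he => S.zsmul_mem (S.list_prod_mem fun a ha => ?_) _
  obtain ⟨v, hv, rfl⟩ := List.mem_map.1 ha
  exact S.pow_mem (h v ((MvPolynomial.mem_vars_iff_mem_support v).2 ⟨e, he, by simpa using hv⟩)) _

theorem map_cEval (f : A →+* B) (x y : ℕ+ → A) (q : MvPolynomial (ℕ+ ⊕ₗ ℕ+) ℤ) :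
    f (cEval x y q) = cEval (fun d => f (x d)) (fun e => f (y e)) q := by
  rw [cEval, map_pEval, cEval]
  congr 1
  funext v
  rcases ofLex v with d | e <;> rfl

theorem cEval_mem_mul {K : Type*} [Field K] [Algebra K A] (C D : Subalgebra K A) {x y : ℕ+ → A}
    {q : MvPolynomial (ℕ+ ⊕ₗ ℕ+) ℤ} (hx : ∀ d, toLex (Sum.inl d) ∈ q.vars → x d ∈ C)
    (hy : ∀ e, toLex (Sum.inr e) ∈ q.vars → y e ∈ D) :
    cEval x y q ∈ Subalgebra.toSubmodule C * Subalgebra.toSubmodule D := by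
  have key : ∀ (f : ℕ+ ⊕ₗ ℕ+ → ℕ) (L : List (ℕ+ ⊕ₗ ℕ+)), L.Pairwise (· ≤ ·) →
      (∀ v ∈ L, v ∈ q.vars) → (L.map fun v => Sum.elim x y (ofLex v) ^ f v).prod ∈
        Subalgebra.toSubmodule C * Subalgebra.toSubmodule D := by
    intro f L hL hv
    induction L with
    | nil => 
      rw [List.map_nil, List.prod_nil, ← one_mul (1 : A)]
      exact Submodule.mul_mem_mul (one_mem C) (one_mem D)
    | cons v L ih =>
      rw [List.pairwise_cons] at hL
      rcases hs : ofLex v with d | e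
      · have hd : x d ∈ C := hx d (by rw [← hs]; exact hv v (by simp))
        rw [List.map_cons, List.prod_cons, hs]
        have := Submodule.mul_mem_mul (show _ ∈ Subalgebra.toSubmodule C from pow_mem hd (f v))
          (ih hL.2 fun w hw => hv w (List.mem_cons_of_mem _ hw))
        rwa [← mul_assoc, Subalgebra.isIdempotentElem_toSubmodule _ |>.eq] at this
      · rw [← one_mul (List.prod _)]
        refine Submodule.mul_mem_mul (one_mem C) (Subalgebra.list_prod_mem D fun a ha => ?_)
        obtain ⟨w, hw, rfl⟩ := List.mem_map.1 ha
        refine pow_mem ?_ _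
        have hle : v ≤ w := by
          rcases List.mem_cons.1 hw with rfl | hw'
          exacts [le_rfl, hL.1 w hw']
        rcases hw' : ofLex w with d' | e'
        · exfalso
          have hv' : v = toLex (Sum.inr e) := by rw [← hs]; rfl
          have hw'' : w = toLex (Sum.inl d') := by rw [← hw']; rfl
          rw [hv', hw''] at hle
          exact Sum.Lex.not_inr_le_inl hle
        · exact hy e' (by rw [← hw']; exact hv w hw)
  rw [cEval, pEval]
  refine Submodule.sum_mem _ fun e he => ?_
  rw [← Int.cast_smul_eq_zsmul K]
  refine Submodule.smul_mem _ _ (key e _ (Finset.pairwise_sort _ _) fun v hv => ?_)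
  exact (MvPolynomial.mem_vars_iff_mem_support v).2 ⟨e, he, by simpa using hv⟩

end Evaluation

section Chain

variable {A : Type*} [Ring A] (p m n : ℕ)

/-- The powers `x_i ^ (p ^ k)` with `i < m`, `k < n`, ordered by increasing `i` and decreasing
`k`. -/
def xPow (x : ℕ → A) (s : ℕ) : A := x (s / n) ^ p ^ (n - 1 - s % n)

/-- The powers `y_k ^ (p ^ i)` dual to the powers `x_i ^ (p ^ k)`. -/
def yPow (y : ℕ → A) (s : ℕ) : A := y (n - 1 - s % n) ^ p ^ (s / n)

/-- The `x_i ^ (p ^ k)`, followed by the `y_k ^ (p ^ i)` in reverse order. -/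
def chain (x y : ℕ → A) (s : ℕ) : A :=
  if s < m * n then xPow p n x s else yPow p n y (2 * (m * n) - 1 - s)

/-- The sequence whose commutators with `chain` are `1`. -/
def dualChain (x y : ℕ → A) (s : ℕ) : A :=
  if s < m * n then yPow p n y s else -xPow p n x (2 * (m * n) - 1 - s)

theorem map_chain {B : Type*} [Ring B] (f : A →+* B) (x y : ℕ → A) (s : ℕ) :
    f (chain p m n x y s) = chain p m n (fun i => f (x i)) (fun j => f (y j)) s := by
  unfold chain xPow yPow
  split_ifs <;> exact map_pow _ _ _

variable {p m n}

theorem lt_of_lt_mul {s : ℕ} (hs : s < m * n) : s / n < m ∧ s % n < n := by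
  have hn : 0 < n := by
    rcases Nat.eq_zero_or_pos n with rfl | h
    · simp at hs
    · exact h
  exact ⟨(Nat.div_lt_iff_lt_mul hn).2 hs, Nat.mod_lt _ hn⟩

theorem chain_commutator {x y : ℕ → A}
    (h : ∀ i < m, ∀ j < n, y j ^ p ^ i * x i ^ p ^ j - x i ^ p ^ j * y j ^ p ^ i = 1) :
    ∀ s < 2 * (m * n), dualChain p m n x y s * chain p m n x y s -
      chain p m n x y s * dualChain p m n x y s = 1 := by
  have key : ∀ s < m * n, yPow p n y s * xPow p n x s - xPow p n x s * yPow p n y s = 1 := by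
    intro s hs
    obtain ⟨h1, h2⟩ := lt_of_lt_mul hs
    exact h _ h1 _ (by omega)
  intro s hs
  unfold chain dualChain
  split_ifs with h
  · exact key s h
  · rw [← key (2 * (m * n) - 1 - s) (by omega)]
    noncomm_ring

theorem chain_commute {x y : ℕ → A} (hx : ∀ i < m, ∀ i' < m, Commute (x i) (x i'))
    (h1 : ∀ i < m, ∀ s < n, ∀ k < n, s < k → Commute (y s) (x i ^ p ^ k))
    (h2 : ∀ i < m, ∀ j < n, ∀ l < m, i < l → Commute (x i) (y j ^ p ^ l)) :
    ∀ s < 2 * (m * n), ∀ i < s, Commute (dualChain p m n x y s) (chain p m n x y i) := by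
  have key : ∀ s < m * n, ∀ i < s, Commute (yPow p n y s) (xPow p n x i) := by
    intro s hs i hi
    obtain ⟨hs1, hs2⟩ := lt_of_lt_mul hs
    obtain ⟨hi1, hi2⟩ := lt_of_lt_mul (hi.trans hs)
    unfold xPow yPow
    rcases (Nat.div_le_div_right hi.le : i / n ≤ s / n).lt_or_eq with hlt | heq
    · exact ((h2 _ hi1 (n - 1 - s % n) (by omega) _ hs1 hlt).pow_left _).symm
    · refine (h1 _ hi1 (n - 1 - s % n) (by omega) (n - 1 - i % n) (by omega) ?_).pow_left _
      have e1 := Nat.div_add_mod i n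
      have e2 := Nat.div_add_mod s n
      rw [heq] at e1
      omega
  have hxx : ∀ s < m * n, ∀ i < m * n, Commute (xPow p n x s) (xPow p n x i) := fun s hs i hi =>
    (hx _ (lt_of_lt_mul hs).1 _ (lt_of_lt_mul hi).1).pow_pow _ _
  intro s hs i hi
  unfold chain dualChain
  split_ifs with h h' h'
  · exact key s h i hi
  · omega
  · exact (hxx _ (by omega) _ h').neg_left
  · exact (key _ (by omega) _ (by omega)).symm.neg_left

variable {K : Type*} [Field K] [Algebra K A]

theorem xPow_pow_mem {x : ℕ → A} {a : ℕ → K} (h : ∀ i < m, x i ^ p ^ n = algebraMap K A (a i))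
    {s : ℕ} (hs : s < m * n) :
    xPow p n x s ^ p ∈ Algebra.adjoin K (xPow p n x '' Set.Iio s) := by
  obtain ⟨h1, h2⟩ := lt_of_lt_mul hs
  rw [xPow, ← pow_mul, ← pow_succ]
  rcases Nat.eq_zero_or_pos (s % n) with h0 | h0
  · rw [h0, show n - 1 - 0 + 1 = n by omega, h _ h1]
    exact Subalgebra.algebraMap_mem _ _
  · refine Algebra.subset_adjoin ⟨s - 1, show s - 1 < s by
      have := Nat.mod_le s n
      omega, ?_⟩
    have e := Nat.div_add_mod s n
    have e' : s - 1 = (s % n - 1) + n * (s / n) := by omega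
    have e1 : (s - 1) / n = s / n := by
      rw [e', Nat.add_mul_div_left _ _ (by omega), Nat.div_eq_of_lt (by omega), zero_add]
    have e2 : (s - 1) % n = s % n - 1 := by
      rw [e', Nat.add_mul_mod_self_left, Nat.mod_eq_of_lt (by omega)]
    rw [xPow, e1, e2]
    congr 2
    omega

theorem yPow_pow_mem {y : ℕ → A} {b : ℕ → K} (h : ∀ j < n, y j ^ p ^ m = algebraMap K A (b j))
    {s : ℕ} (hs : s < m * n) :
    yPow p n y (m * n - 1 - s) ^ p ∈
      Algebra.adjoin K ((fun i => yPow p n y (m * n - 1 - i)) '' Set.Iio s) := by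
  obtain ⟨h1, h2⟩ := lt_of_lt_mul (m := m) (n := n) (s := m * n - 1 - s) (by omega)
  set q := m * n - 1 - s with hq
  rw [yPow, ← pow_mul, ← pow_succ]
  rcases Nat.lt_or_ge (q / n + 1) m with h0 | h0
  · have hlt : q + n < m * n := by
      have e := Nat.div_add_mod q n
      have := Nat.mul_le_mul_right n (show q / n + 1 + 1 ≤ m from h0)
      rw [add_mul, add_mul, one_mul, mul_comm (q / n)] at this
      omega
    refine Algebra.subset_adjoin ⟨s - n, show s - n < s by omega, ?_⟩
    dsimp only
    rw [show m * n - 1 - (s - n) = q + n by omega, yPow, Nat.add_mod_right,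
      Nat.add_div_right _ (by omega)]
  · rw [show q / n + 1 = m by omega, h _ (by omega)]
    exact Subalgebra.algebraMap_mem _ _

theorem mem_adjoin_xPow {x : ℕ → A} {a : ℕ → K} (h : ∀ i < m, x i ^ p ^ n = algebraMap K A (a i))
    {i : ℕ} (hi : i < m) : x i ∈ Algebra.adjoin K (xPow p n x '' Set.Iio (m * n)) := by
  rcases Nat.eq_zero_or_pos n with rfl | hn
  · rw [← pow_one (x i), ← pow_zero p, h i hi]
    exact Subalgebra.algebraMap_mem _ _
  · refine Algebra.subset_adjoin ⟨(n - 1) + n * i, show (n - 1) + n * i < m * n by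
      have := Nat.mul_le_mul_left n (show i + 1 ≤ m from hi)
      rw [mul_add, mul_comm n m] at this
      omega, ?_⟩
    rw [xPow, Nat.add_mul_div_left _ _ hn, Nat.div_eq_of_lt (by omega), zero_add,
      Nat.add_mul_mod_self_left, Nat.mod_eq_of_lt (by omega), Nat.sub_self, pow_zero, pow_one]

theorem mem_adjoin_yPow {y : ℕ → A} {b : ℕ → K} (h : ∀ j < n, y j ^ p ^ m = algebraMap K A (b j))
    {j : ℕ} (hj : j < n) :
    y j ∈ Algebra.adjoin K ((fun i => yPow p n y (m * n - 1 - i)) '' Set.Iio (m * n)) := by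
  rcases Nat.eq_zero_or_pos m with rfl | hm
  · rw [← pow_one (y j), ← pow_zero p, h j hj]
    exact Subalgebra.algebraMap_mem _ _
  · have hmn : n ≤ m * n := Nat.le_mul_of_pos_left n hm
    refine Algebra.subset_adjoin ⟨m * n - 1 - (n - 1 - j),
      show m * n - 1 - (n - 1 - j) < m * n by omega, ?_⟩
    dsimp only
    rw [show m * n - 1 - (m * n - 1 - (n - 1 - j)) = n - 1 - j by omega, yPow,
      Nat.div_eq_of_lt (by omega), Nat.mod_eq_of_lt (by omega), pow_zero, pow_one]
    congr 1
    omega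

theorem digitTower_chain_eq_top (hp : 0 < p) {x y : ℕ → A}
    (hx : ∀ i < m, ∀ i' < m, Commute (x i) (x i'))
    (hy : ∀ j < n, ∀ j' < n, Commute (y j) (y j')) {a b : ℕ → K}
    (ha : ∀ i < m, x i ^ p ^ n = algebraMap K A (a i))
    (hb : ∀ j < n, y j ^ p ^ m = algebraMap K A (b j))
    (hyx : ∀ j < n, ∀ i < m, y j * x i - x i * y j ∈
      Subalgebra.toSubmodule (Algebra.adjoin K (x '' Set.Iio m)) *
        Subalgebra.toSubmodule (Algebra.adjoin K (y '' Set.Iio j)))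
    (htop : Algebra.adjoin K (x '' Set.Iio m ∪ y '' Set.Iio n) = ⊤) :
    digitTower p (1 : Submodule K A) (chain p m n x y) (2 * (m * n)) = ⊤ := by
  set C := Algebra.adjoin K (x '' Set.Iio m)
  set D := Algebra.adjoin K (y '' Set.Iio n)
  have hCD : Subalgebra.toSubmodule C * Subalgebra.toSubmodule D = ⊤ := by
    have hDC := adjoin_mul_adjoin_le (S := x '' Set.Iio m) (y := y) (n := n)
      (fun j hj g hg => by obtain ⟨i, hi, rfl⟩ := hg; exact hyx j hj i hi) le_rfl
    refine eq_top_iff.2 fun v _ => ?_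
    have hv : v ∈ Algebra.adjoin K (x '' Set.Iio m ∪ y '' Set.Iio n) := htop ▸ Algebra.mem_top
    rw [← mul_one v, ← mul_one (1 : A)]
    refine mem_adjoin_mul_mem ?_ (Submodule.mul_mem_mul (one_mem C) (one_mem D)) hv
    rintro w hw g (⟨i, hi, rfl⟩ | ⟨j, hj, rfl⟩)
    · have := Submodule.mul_mem_mul
        (show x i ∈ Subalgebra.toSubmodule C from Algebra.subset_adjoin ⟨i, hi, rfl⟩) hw
      rwa [← mul_assoc, Subalgebra.isIdempotentElem_toSubmodule _ |>.eq] at this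
    · have := Submodule.mul_mem_mul
        (show y j ∈ Subalgebra.toSubmodule D from Algebra.subset_adjoin ⟨j, hj, rfl⟩) hw
      rw [← mul_assoc] at this
      have := mul_le_mul_left hDC _ this
      rwa [mul_assoc, Subalgebra.isIdempotentElem_toSubmodule _ |>.eq] at this
  have h1 : digitTower p (1 : Submodule K A) (chain p m n x y) (m * n) =
      digitTower p 1 (xPow p n x) (m * n) :=
    digitTower_congr _ _ fun i hi => by rw [chain, if_pos hi]
  have h2 : digitTower p (digitTower p (1 : Submodule K A) (xPow p n x) (m * n))
      (fun i => chain p m n x y (m * n + i)) (m * n) =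
      digitTower p (digitTower p 1 (xPow p n x) (m * n))
        (fun i => yPow p n y (m * n - 1 - i)) (m * n) :=
    digitTower_congr _ _ fun i hi => by
      rw [chain, if_neg (by omega)]
      congr 1
      omega
  rw [two_mul, digitTower_add, h1, h2, eq_top_iff, ← hCD]
  refine Submodule.mul_le.2 fun u hu v hv => ?_
  refine mul_mem_digitTower hp _ (h := fun i => yPow p n y (m * n - 1 - i)) (r := m * n)
    (fun i hi j hj => ?_) (fun s hs => yPow_pow_mem hb hs) le_rfl
    (le_digitTower hp _ _ _ ?_) ?_
  · obtain ⟨_, h4⟩ := lt_of_lt_mul (m := m) (n := n) (s := m * n - 1 - i) (by omega)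
    obtain ⟨_, h6⟩ := lt_of_lt_mul (m := m) (n := n) (s := m * n - 1 - j) (by omega)
    exact (hy _ (by omega) _ (by omega)).pow_pow _ _
  · rw [← one_mul u]
    refine mul_mem_digitTower hp _ (r := m * n) (fun i hi j hj => ?_)
      (fun s hs => xPow_pow_mem ha hs) le_rfl
      (le_digitTower hp _ _ _ (Submodule.one_le.1 le_rfl)) ?_
    · exact (hx _ (lt_of_lt_mul hi).1 _ (lt_of_lt_mul hj).1).pow_pow _ _
    · refine Algebra.adjoin_le ?_ hu
      rintro _ ⟨i, hi, rfl⟩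
      exact mem_adjoin_xPow ha hi
  · refine Algebra.adjoin_le ?_ hv
    rintro _ ⟨j, hj, rfl⟩
    exact mem_adjoin_yPow hb hj

end Chain

section Conclusion

variable {K A : Type*} [Field K] [Ring A] [Algebra K A] {p : ℕ}

theorem injective_of_digitTower [CharP K p] {A' : Type*} [Ring A'] [Algebra K A'] [Nontrivial A']
    (φ : A →ₐ[K] A') {g : ℕ → A} {N : ℕ} (htop : digitTower p (1 : Submodule K A) g N = ⊤)
    {gs : ℕ → A'} (h1 : ∀ s < N, gs s * φ (g s) - φ (g s) * gs s = 1)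
    (h0 : ∀ s < N, ∀ i < s, Commute (gs s) (φ (g i))) : Function.Injective φ := by
  have hone : Module.Finite K (1 : Submodule K A) := by
    rw [Submodule.one_eq_span]
    infer_instance
  have hfin : Module.Finite K A := by
    have := finite_digitTower p (1 : Submodule K A) g N
    rw [htop] at this
    exact Module.finite_def.2 ((Submodule.fg_top _).1 (Module.finite_def.1 this))
  have hle : Module.finrank K A ≤ p ^ N := by
    have := finrank_digitTower_le p (1 : Submodule K A) g N
    rw [htop, finrank_top, Submodule.one_eq_span] at this
    exact this.trans (mul_le_of_le_one_right (Nat.zero_le _)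
      ((finrank_span_le_card ({1} : Set A)).trans (by simp)))
  have hrange := finrank_digitTower (K := K) p h1 h0 (le_refl N)
  have hmap := map_digitTower φ p (1 : Submodule K A) g N
  rw [Submodule.map_one, htop, Submodule.map_top] at hmap
  rw [← hmap] at hrange
  have hker := LinearMap.finrank_range_add_finrank_ker φ.toLinearMap
  have hz : Module.finrank K (LinearMap.ker φ.toLinearMap) = 0 := by omega
  exact LinearMap.ker_eq_bot.1 (Submodule.finrank_eq_zero.1 hz)

theorem centralSimple_of_digitTower [Fact p.Prime] [CharP K p] [Nontrivial A] {g gs : ℕ → A}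
    {N : ℕ} (h1 : ∀ s < N, gs s * g s - g s * gs s = 1)
    (h0 : ∀ s < N, ∀ i < s, Commute (gs s) (g i))
    (htop : digitTower p (1 : Submodule K A) g N = ⊤) :
    Subalgebra.center K A = ⊥ ∧ IsSimpleRing A ∧ Module.finrank K A = p ^ N := by
  refine ⟨eq_bot_iff.2 fun z hz => ?_, ⟨⟨fun I => ?_⟩⟩, ?_⟩
  · obtain ⟨k, hk⟩ := Submodule.mem_one.1 (mem_one_of_commute p h1 h0 (le_refl N) (v := z)
      (htop ▸ Submodule.mem_top) fun t _ => Subalgebra.mem_center_iff.1 hz _)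
    exact Algebra.mem_bot.2 ⟨k, hk⟩
  · refine or_iff_not_imp_left.2 fun hI => ?_
    obtain ⟨v, hvI, hv0⟩ : ∃ v ∈ I, v ≠ 0 := by
      by_contra! hcon
      exact hI (eq_bot_iff.2 fun v hv => (TwoSidedIdeal.mem_bot A).2 (hcon v hv))
    let J : Submodule K A :=
      { carrier := I
        add_mem' := fun ha hb => I.add_mem ha hb
        zero_mem' := I.zero_mem
        smul_mem' := fun k a ha => by
          rw [Algebra.smul_def]
          exact I.mul_mem_left _ _ ha }
    obtain ⟨k, hk, hkI⟩ := exists_algebraMap_mem p h1 h0 J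
      (fun s _ v hv => I.sub_mem (I.mul_mem_left _ _ hv) (I.mul_mem_right _ _ hv)) (le_refl N)
      (v := v) (htop ▸ Submodule.mem_top) hvI hv0
    have hkI : algebraMap K A k ∈ I := hkI
    have := I.mul_mem_left (algebraMap K A k⁻¹) _ hkI
    rw [← map_mul, inv_mul_cancel₀ hk, map_one] at this
    exact I.one_mem_iff.1 this
  · rw [← finrank_digitTower (K := K) p h1 h0 (le_refl N), htop, finrank_top]

end Conclusion

section Ghost

theorem ghost_eq_sum {A : Type*} [Ring A] (g : ℕ+ → A) (k : ℕ+) :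
    ghost g k = ∑ d ∈ (k : ℕ).divisors, (d : A) * g d.toPNat' ^ ((k : ℕ) / d) := by
  rw [ghost, ← Finset.sum_attach (k : ℕ).divisors]
  refine Finset.sum_congr rfl fun d _ => ?_
  congr 3
  exact PNat.eq (PNat.toPNat'_coe (Nat.pos_of_mem_divisors d.2)).symm

theorem ghost_eq {A : Type*} [Ring A] (g : ℕ+ → A) (k : ℕ+) :
    ghost g k = (∑ d ∈ (k : ℕ).properDivisors, (d : A) * g d.toPNat' ^ ((k : ℕ) / d)) +
      ((k : ℕ) : A) * g k := by
  rw [ghost_eq_sum, ← Nat.insert_self_properDivisors k.ne_zero,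
    Finset.sum_insert Nat.self_notMem_properDivisors, add_comm]
  rw [Nat.div_self k.pos, pow_one, PNat.coe_toPNat']

theorem toPNat'_lt_of_mem_properDivisors {k : ℕ+} {d : ℕ} (hd : d ∈ (k : ℕ).properDivisors) :
    d.toPNat' < k := by
  have h := Nat.mem_properDivisors.1 hd
  rw [← PNat.coe_lt_coe, PNat.toPNat'_coe (Nat.pos_of_mem_properDivisors hd)]
  exact h.2

theorem map_ghost {A B : Type*} [Ring A] [Ring B] (f : A →+* B) (g : ℕ+ → A) (k : ℕ+) :
    f (ghost g k) = ghost (fun d => f (g d)) k := by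
  simp [ghost]

theorem ghost_ppow {A : Type*} [Ring A] (p : ℕ) [hp : Fact p.Prime] (g : ℕ+ → A) (i : ℕ) :
    ghost g (ppow p i) = pGhost p (fun j => g (ppow p j)) i := by
  have h : ((ppow p i : ℕ+) : ℕ) = p ^ i := PNat.toPNat'_coe (pow_pos hp.out.pos i)
  rw [ghost_eq_sum, h, Nat.sum_divisors_prime_pow hp.out, pGhost]
  refine Finset.sum_congr rfl fun s hs => ?_
  rw [Nat.pow_div (by simpa [Nat.lt_succ_iff] using hs) hp.out.pos]
  rfl

variable {E : Type*} [Ring E] [Algebra ℚ E]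

theorem natCast_mul_cancel (k : ℕ+) {u v : E} (h : ((k : ℕ) : E) * u = ((k : ℕ) : E) * v) :
    u = v := by
  have hk : ((k : ℕ) : ℚ) ≠ 0 := Nat.cast_ne_zero.2 k.ne_zero
  rw [← map_natCast (algebraMap ℚ E), ← Algebra.smul_def, ← Algebra.smul_def] at h
  exact smul_right_injective E hk h

/-- The sequence with prescribed ghost components. -/
def ghostInv (h : ℕ+ → E) (k : ℕ+) : E :=
  ((k : ℕ) : ℚ)⁻¹ • (h k - ∑ d ∈ (k : ℕ).properDivisors.attach,
    ((d : ℕ) : E) * ghostInv h (d : ℕ).toPNat' ^ ((k : ℕ) / (d : ℕ)))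
termination_by k
decreasing_by exact toPNat'_lt_of_mem_properDivisors d.2

theorem ghost_ghostInv (h : ℕ+ → E) (k : ℕ+) : ghost (ghostInv h) k = h k := by
  have hk : ((k : ℕ) : ℚ) ≠ 0 := Nat.cast_ne_zero.2 k.ne_zero
  rw [ghost_eq, ghostInv, ← map_natCast (algebraMap ℚ E), ← Algebra.smul_def, smul_smul,
    mul_inv_cancel₀ hk, one_smul, Finset.sum_attach _ (fun d : ℕ =>
      (d : E) * ghostInv h d.toPNat' ^ ((k : ℕ) / d)), add_sub_cancel]

theorem ghost_injective {u v : ℕ+ → E} (h : ∀ k, ghost u k = ghost v k) (k : ℕ+) : u k = v k := by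
  induction k using PNat.strongInductionOn with
  | _ k ih =>
    refine natCast_mul_cancel k ?_
    have := h k
    rw [ghost_eq, ghost_eq, Finset.sum_congr rfl fun d hd => by
      rw [ih _ (toPNat'_lt_of_mem_properDivisors hd)]] at this
    exact add_left_cancel this

theorem commute_of_commute_ghost {z : E} {u : ℕ+ → E} (h : ∀ k, Commute z (ghost u k)) (k : ℕ+) :
    Commute z (u k) := by
  induction k using PNat.strongInductionOn with
  | _ k ih =>
    have hk : Commute z (((k : ℕ) : E) * u k) := by
      rw [← sub_eq_iff_eq_add'.2 (ghost_eq u k)]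
      refine (h k).sub_right (Commute.sum_right _ _ _ fun d hd => ?_)
      exact (Nat.cast_commute _ z).symm.mul_right
        ((ih _ (toPNat'_lt_of_mem_properDivisors hd)).pow_right _)
    refine natCast_mul_cancel k ?_
    have := hk.eq
    rw [← mul_assoc, ← Nat.cast_comm] at this
    rw [← mul_assoc, this, mul_assoc]

/-- The defining commutators of `B(ℚ)`, in any `ℚ`-algebra in which the ghost components satisfy
the relations of `B(ℚ)`. -/
theorem cEval_eq_commutator {c : ℕ+ → ℕ+ → MvPolynomial (ℕ+ ⊕ₗ ℕ+) ℤ} (hc : IsCFamily c)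
    {x y : ℕ+ → E} (hxx : ∀ k l, Commute (ghost x k) (ghost x l))
    (hyy : ∀ k l, Commute (ghost y k) (ghost y l))
    (hyx : ∀ k l, ghost y l * ghost x k =
      ghost x k * ghost y l + if k = l then ((k : ℕ) : E) else 0) (m n : ℕ+) :
    cEval x y (c m n) = y n * x m - x m * y n := by
  let Φ : FreeAlgebra ℚ (ℕ+ ⊕ ℕ+) →ₐ[ℚ] E := FreeAlgebra.lift ℚ (Sum.elim x y)
  have hX : ∀ d, Φ.toRingHom (bXf d) = x d := fun d => by simp [Φ, bXf]
  have hY : ∀ d, Φ.toRingHom (bYf d) = y d := fun d => by simp [Φ, bYf]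
  have hgX : ∀ k, Φ (ghost bXf k) = ghost x k := fun k => by
    have := map_ghost Φ.toRingHom bXf k
    simp only [hX] at this
    exact this
  have hgY : ∀ k, Φ (ghost bYf k) = ghost y k := fun k => by
    have := map_ghost Φ.toRingHom bYf k
    simp only [hY] at this
    exact this
  have hrel : ∀ ⦃u v⦄, BRel u v → Φ u = Φ v := by
    rintro _ _ (⟨k, l⟩ | ⟨k, l⟩ | ⟨k, l⟩)
    · rw [map_mul, map_mul, hgX, hgX, (hxx k l).eq]
    · rw [map_mul, map_mul, hgY, hgY, (hyy k l).eq]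
    · rw [map_mul, map_add, map_mul, hgX, hgY, hyx]
      congr 1
      split_ifs <;> simp
  let Ψ : BQ →ₐ[ℚ] E := RingQuot.liftAlgHom ℚ ⟨Φ, hrel⟩
  have hΨX : ∀ d, Ψ.toRingHom (bx d) = x d := fun d =>
    (RingQuot.liftAlgHom_mkAlgHom_apply ℚ Φ hrel (bXf d)).trans (hX d)
  have hΨY : ∀ d, Ψ.toRingHom (by' d) = y d := fun d =>
    (RingQuot.liftAlgHom_mkAlgHom_apply ℚ Φ hrel (bYf d)).trans (hY d)
  have := congrArg Ψ.toRingHom (hc m n).2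
  rwa [map_cEval, map_sub, map_mul, map_mul, hΨX, hΨY, funext hΨX, funext hΨY] at this

end Ghost

section WeylModel

open MvPolynomial

theorem pderiv_pderiv_comm {σ R : Type*} [CommRing R] (i j : σ) (f : MvPolynomial σ R) :
    pderiv i (pderiv j f) = pderiv j (pderiv i f) := by
  classical
  have h : ⁅pderiv (R := R) i, pderiv (R := R) j⁆ = 0 := by
    refine derivation_ext fun k => ?_
    rw [Derivation.commutator_apply, pderiv_X, pderiv_X, Pi.single_apply, Pi.single_apply]
    split_ifs <;> simp
  have := congrArg (fun D => D f) h
  rwa [Derivation.commutator_apply, Derivation.zero_apply, sub_eq_zero] at this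

/-- Multiplication operators on polynomials in the ghost components `ξ_k` and `θ_l`. -/
def mulOp : MvPolynomial (ℕ+ ⊕ ℕ+) ℚ →ₐ[ℚ] Module.End ℚ (MvPolynomial (ℕ+ ⊕ ℕ+) ℚ) :=
  Algebra.lmul ℚ _

@[simp] theorem mulOp_apply (f g : MvPolynomial (ℕ+ ⊕ ℕ+) ℚ) : mulOp f g = f * g := rfl

/-- The operator `l ∂/∂ξ_l + θ_l`. -/
def etaOp (l : ℕ+) : Module.End ℚ (MvPolynomial (ℕ+ ⊕ ℕ+) ℚ) :=
  ((l : ℕ) : ℚ) • (pderiv (Sum.inl l)).toLinearMap + mulOp (X (Sum.inr l))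

theorem etaOp_apply (l : ℕ+) (f : MvPolynomial (ℕ+ ⊕ ℕ+) ℚ) :
    etaOp l f = ((l : ℕ) : ℚ) • pderiv (Sum.inl l) f + X (Sum.inr l) * f := rfl

theorem etaOp_commute (k l : ℕ+) : Commute (etaOp k) (etaOp l) := by
  refine LinearMap.ext fun f => ?_
  simp only [Module.End.mul_apply, etaOp_apply, map_add, Derivation.map_smul, pderiv_mul]
  rw [pderiv_X_of_ne (by simp), pderiv_X_of_ne (by simp), pderiv_pderiv_comm]
  simp only [smul_eq_C_mul]
  ring

theorem etaOp_commute_mulOp_inr (k l : ℕ+) : Commute (etaOp k) (mulOp (X (Sum.inr l))) := by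
  refine LinearMap.ext fun f => ?_
  simp only [Module.End.mul_apply, etaOp_apply, mulOp_apply, pderiv_mul]
  rw [pderiv_X_of_ne (by simp)]
  simp only [zero_mul, zero_add, mul_add, mul_smul_comm]
  rw [mul_left_comm]

theorem etaOp_mul_mulOp_inl (k l : ℕ+) : etaOp l * mulOp (X (Sum.inl k)) =
    mulOp (X (Sum.inl k)) * etaOp l +
      if k = l then ((k : ℕ) : Module.End ℚ (MvPolynomial (ℕ+ ⊕ ℕ+) ℚ)) else 0 := by
  refine LinearMap.ext fun f => ?_
  simp only [Module.End.mul_apply, LinearMap.add_apply, etaOp_apply, mulOp_apply, pderiv_mul]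
  split_ifs with h
  · subst h
    rw [pderiv_X_self, Module.End.natCast_apply]
    simp only [one_mul, smul_add, mul_add, mul_smul_comm, mul_left_comm (X (Sum.inr k))]
    rw [Nat.cast_smul_eq_nsmul]
    abel
  · rw [pderiv_X_of_ne (by simpa using h)]
    simp only [zero_mul, zero_add, mul_add, mul_smul_comm, mul_left_comm (X (Sum.inr l))]
    simp

/-- The Witt coordinates with ghost components `ξ_k`. -/
def xPoly : ℕ+ → MvPolynomial (ℕ+ ⊕ ℕ+) ℚ := ghostInv fun k => X (Sum.inl k)

/-- The Witt coordinates with ghost components `θ_k`. -/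
def tPoly : ℕ+ → MvPolynomial (ℕ+ ⊕ ℕ+) ℚ := ghostInv fun k => X (Sum.inr k)

/-- The operators with ghost components `l ∂/∂ξ_l + θ_l`. -/
def yOp : ℕ+ → Module.End ℚ (MvPolynomial (ℕ+ ⊕ ℕ+) ℚ) := ghostInv etaOp

theorem ghost_mulOp_xPoly (k : ℕ+) :
    ghost (fun d => mulOp (xPoly d)) k = mulOp (X (Sum.inl k)) := by
  rw [← ghost_ghostInv (fun k => (X (Sum.inl k) : MvPolynomial (ℕ+ ⊕ ℕ+) ℚ)) k]
  exact (map_ghost mulOp.toRingHom xPoly k).symm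

theorem ghost_mulOp_tPoly (k : ℕ+) :
    ghost (fun d => mulOp (tPoly d)) k = mulOp (X (Sum.inr k)) := by
  rw [← ghost_ghostInv (fun k => (X (Sum.inr k) : MvPolynomial (ℕ+ ⊕ ℕ+) ℚ)) k]
  exact (map_ghost mulOp.toRingHom tPoly k).symm

theorem ghost_yOp (k : ℕ+) : ghost yOp k = etaOp k := ghost_ghostInv etaOp k

theorem mulOp_commute (f g : MvPolynomial (ℕ+ ⊕ ℕ+) ℚ) : Commute (mulOp f) (mulOp g) := by
  rw [Commute, SemiconjBy, ← map_mul, mul_comm, map_mul]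

theorem yOp_commute (k l : ℕ+) : Commute (yOp k) (yOp l) := by
  refine commute_of_commute_ghost (fun l => (commute_of_commute_ghost (fun k => ?_) k).symm) l
  rw [ghost_yOp, ghost_yOp]
  exact etaOp_commute _ _

theorem yOp_commute_mulOp_tPoly (k l : ℕ+) : Commute (yOp k) (mulOp (tPoly l)) := by
  refine commute_of_commute_ghost (u := fun l => mulOp (tPoly l))
    (fun l => (commute_of_commute_ghost (fun k => ?_) k).symm) l
  rw [ghost_yOp, ghost_mulOp_tPoly]
  exact (etaOp_commute_mulOp_inr _ _).symm

theorem yOp_pow_one {k : ℕ+} (h : yOp k 1 = tPoly k) (e : ℕ) : (yOp k ^ e) 1 = tPoly k ^ e := by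
  induction e with
  | zero => rfl
  | succ e ih =>
    have := congrArg (fun T => T 1) ((yOp_commute_mulOp_tPoly k k).pow_left e).eq
    rw [pow_succ, Module.End.mul_apply, h, ← mul_one (tPoly k)]
    simp only [Module.End.mul_apply, mulOp_apply] at this
    rw [this, ih, mul_one, pow_succ']

theorem yOp_one (k : ℕ+) : yOp k 1 = tPoly k := by
  induction k using PNat.strongInductionOn with
  | _ k ih =>
    refine natCast_mul_cancel k ?_
    have h1 := congrArg (fun T => T 1) (ghost_yOp k)
    have h2 : ghost tPoly k = _ :=
      ghost_ghostInv (fun k => (X (Sum.inr k) : MvPolynomial (ℕ+ ⊕ ℕ+) ℚ)) k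
    rw [ghost_eq] at h1 h2
    simp only [etaOp_apply, pderiv_one, smul_zero, zero_add, mul_one, LinearMap.add_apply,
      LinearMap.sum_apply, Module.End.mul_apply, Module.End.natCast_apply] at h1
    rw [← h2, Finset.sum_congr rfl fun d hd => by
      rw [yOp_pow_one (ih _ (toPNat'_lt_of_mem_properDivisors hd)), nsmul_eq_mul]] at h1
    rw [nsmul_eq_mul] at h1
    exact add_left_cancel h1

theorem cEval_yOp {c : ℕ+ → ℕ+ → MvPolynomial (ℕ+ ⊕ₗ ℕ+) ℤ} (hc : IsCFamily c) (m n : ℕ+) :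
    cEval (fun d => mulOp (xPoly d)) yOp (c m n) =
      yOp n * mulOp (xPoly m) - mulOp (xPoly m) * yOp n := by
  refine cEval_eq_commutator hc (fun k l => ?_) (fun k l => ?_) (fun k l => ?_) m n
  · rw [ghost_mulOp_xPoly, ghost_mulOp_xPoly]
    exact mulOp_commute _ _
  · rw [ghost_yOp, ghost_yOp]
    exact etaOp_commute _ _
  · rw [ghost_mulOp_xPoly, ghost_yOp]
    exact etaOp_mul_mulOp_inl k l

/-- The polynomials with integral coefficients in the Witt coordinates. -/
def wittCoord : MvPolynomial (ℕ+ ⊕ ℕ+) ℤ →ₐ[ℤ] MvPolynomial (ℕ+ ⊕ ℕ+) ℚ :=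
  aeval (Sum.elim xPoly tPoly)

theorem wittCoord_injective : Function.Injective wittCoord := by
  let β : MvPolynomial (ℕ+ ⊕ ℕ+) ℚ →ₐ[ℚ] MvPolynomial (ℕ+ ⊕ ℕ+) ℚ :=
    aeval (Sum.elim (ghost fun d => X (Sum.inl d)) (ghost fun d => X (Sum.inr d)))
  have hx : ∀ d, β (xPoly d) = X (Sum.inl d) := by
    refine ghost_injective (u := fun d => β (xPoly d)) fun k => ?_
    refine (map_ghost β.toRingHom xPoly k).symm.trans ?_
    rw [xPoly, ghost_ghostInv]
    simp [β]
  have ht : ∀ d, β (tPoly d) = X (Sum.inr d) := by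
    refine ghost_injective (u := fun d => β (tPoly d)) fun k => ?_
    refine (map_ghost β.toRingHom tPoly k).symm.trans ?_
    rw [tPoly, ghost_ghostInv]
    simp [β]
  have hcomp : (β.toRingHom.comp wittCoord.toRingHom) = MvPolynomial.map (Int.castRingHom ℚ) := by
    refine ringHom_ext (fun r => by simp) fun v => ?_
    rcases v with d | d
    · simpa [wittCoord] using hx d
    · simpa [wittCoord] using ht d
  have hinj : Function.Injective (β.toRingHom.comp wittCoord.toRingHom) := by
    rw [hcomp]
    exact map_injective _ Int.cast_injective
  exact Function.Injective.of_comp (f := β) hinj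

/-- The operators preserving the integral polynomials in the Witt coordinates. -/
def integralOps : Subring (Module.End ℚ (MvPolynomial (ℕ+ ⊕ ℕ+) ℚ)) where
  carrier := {T | ∀ v ∈ wittCoord.range, T v ∈ wittCoord.range}
  mul_mem' hS hT v hv := hS _ (hT v hv)
  one_mem' _ hv := hv
  add_mem' hS hT v hv := add_mem (hS v hv) (hT v hv)
  zero_mem' _ _ := zero_mem _
  neg_mem' hT v hv := neg_mem (hT v hv)

theorem mulOp_mem_integralOps {f : MvPolynomial (ℕ+ ⊕ ℕ+) ℚ} (hf : f ∈ wittCoord.range) :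
    mulOp f ∈ integralOps := fun _ hv => mul_mem hf hv

theorem xPoly_mem (d : ℕ+) : xPoly d ∈ wittCoord.range := ⟨X (Sum.inl d), by simp [wittCoord]⟩

theorem tPoly_mem (d : ℕ+) : tPoly d ∈ wittCoord.range := ⟨X (Sum.inr d), by simp [wittCoord]⟩

theorem yOp_mem_integralOps {c : ℕ+ → ℕ+ → MvPolynomial (ℕ+ ⊕ₗ ℕ+) ℤ} (hc : IsCFamily c)
    (n : ℕ+) : yOp n ∈ integralOps := by
  induction n using PNat.strongInductionOn with
  | _ n ih =>
    rintro _ ⟨f, rfl⟩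
    induction f using MvPolynomial.induction_on with
    | C a =>
      have h : wittCoord (C a) = a • 1 := by simp [wittCoord]
      change yOp n (wittCoord (C a)) ∈ _
      rw [h, map_zsmul, yOp_one]
      exact zsmul_mem (tPoly_mem n) a
    | add f g hf hg =>
      change yOp n (wittCoord (f + g)) ∈ _
      rw [map_add, map_add]
      exact add_mem hf hg
    | mul_X f v hf =>
      change yOp n (wittCoord (f * X v)) ∈ _
      rw [map_mul, mul_comm]
      have hf' : wittCoord f ∈ wittCoord.range := ⟨f, rfl⟩
      rcases v with d | d
      · have h1 : wittCoord (X (Sum.inl d)) = xPoly d := by simp [wittCoord]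
        have h2 := congrArg (fun T => T (wittCoord f)) (eq_add_of_sub_eq' (cEval_yOp hc d n).symm)
        simp only [Module.End.mul_apply, LinearMap.add_apply, mulOp_apply] at h2
        rw [h1, h2]
        refine add_mem (mul_mem (xPoly_mem d) hf) ?_
        refine pEval_mem integralOps (fun v hv => ?_) _ hf'
        rcases (hc d n).1 v hv with ⟨e, -, -, he⟩ | ⟨e, he1, he2, he⟩
        · rw [he]
          exact mulOp_mem_integralOps (xPoly_mem e)
        · rw [he]
          exact ih e (lt_of_le_of_ne (Nat.le_of_dvd n.pos he1) he2)
      · have h1 : wittCoord (X (Sum.inr d)) = tPoly d := by simp [wittCoord]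
        have h2 := congrArg (fun T => T (wittCoord f)) (yOp_commute_mulOp_tPoly n d).eq
        simp only [Module.End.mul_apply, mulOp_apply] at h2
        rw [h1, h2]
        exact mul_mem (tPoly_mem d) hf

end WeylModel

section PrimePowers

variable (p : ℕ) [hp : Fact p.Prime]

theorem coe_ppow (i : ℕ) : ((ppow p i : ℕ+) : ℕ) = p ^ i :=
  PNat.toPNat'_coe (pow_pos hp.out.pos i)

theorem padicValNat_ppow (i : ℕ) : padicValNat p (ppow p i : ℕ) = i := by
  rw [coe_ppow, padicValNat.prime_pow]

theorem exists_eq_ppow {d : ℕ+} {i : ℕ} (hd : (d : ℕ) ∣ (ppow p i : ℕ)) (hne : d ≠ ppow p i) :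
    ∃ r < i, d = ppow p r := by
  rw [coe_ppow] at hd
  obtain ⟨r, hr, h⟩ := (Nat.dvd_prime_pow hp.out).1 hd
  have h : d = ppow p r := PNat.eq (by rw [h, coe_ppow])
  exact ⟨r, lt_of_le_of_ne hr fun h' => hne (by rw [h, h']), h⟩

variable {p} {c : ℕ+ → ℕ+ → MvPolynomial (ℕ+ ⊕ₗ ℕ+) ℤ} (hc : IsCFamily c)

include hc in
theorem exists_of_inl_mem_vars {i j : ℕ} {d : ℕ+}
    (hd : toLex (Sum.inl d) ∈ (c (ppow p i) (ppow p j)).vars) : ∃ r < i, d = ppow p r := by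
  rcases (hc _ _).1 _ hd with ⟨e, h1, h2, h⟩ | ⟨e, h1, h2, h⟩
  · obtain rfl := Sum.inl_injective h
    exact exists_eq_ppow p h1 h2
  · simp at h

include hc in
theorem exists_of_inr_mem_vars {i j : ℕ} {d : ℕ+}
    (hd : toLex (Sum.inr d) ∈ (c (ppow p i) (ppow p j)).vars) : ∃ r < j, d = ppow p r := by
  rcases (hc _ _).1 _ hd with ⟨e, h1, h2, h⟩ | ⟨e, h1, h2, h⟩
  · simp at h
  · obtain rfl := Sum.inr_injective h
    exact exists_eq_ppow p h1 h2

include hc in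
theorem cEval_ppow_congr {A : Type*} [Ring A] {x x' y y' : ℕ+ → A} {i j : ℕ}
    (hx : ∀ r < i, x (ppow p r) = x' (ppow p r)) (hy : ∀ r < j, y (ppow p r) = y' (ppow p r)) :
    cEval x y (c (ppow p i) (ppow p j)) = cEval x' y' (c (ppow p i) (ppow p j)) := by
  refine pEval_congr fun v hv => ?_
  rcases h : ofLex v with d | d
  · obtain ⟨r, hr, rfl⟩ := exists_of_inl_mem_vars hc (d := d) (by rw [← h]; exact hv)
    exact hx r hr
  · obtain ⟨r, hr, rfl⟩ := exists_of_inr_mem_vars hc (d := d) (by rw [← h]; exact hv)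
    exact hy r hr

end PrimePowers

section ModularModel

open MvPolynomial TensorProduct

/-- The action of the integral operators on the integral polynomials in the Witt coordinates. -/
def restrictOp : integralOps →+* Module.End ℤ wittCoord.range where
  toFun T := (T.1.restrictScalars ℤ).restrict (p := Subalgebra.toSubmodule wittCoord.range)
    (q := Subalgebra.toSubmodule wittCoord.range) T.2
  map_one' := rfl
  map_mul' _ _ := rfl
  map_zero' := rfl
  map_add' _ _ := rfl

theorem coe_restrictOp (T : integralOps) (v : wittCoord.range) :
    (restrictOp T v : MvPolynomial (ℕ+ ⊕ ℕ+) ℚ) = T.1 v := rfl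

/-- The base change to `K` of the action of the integral operators. -/
def modularRep (K : Type*) [Field K] : integralOps →+* Module.End K (K ⊗[ℤ] wittCoord.range) :=
  (Module.End.baseChangeHom ℤ K wittCoord.range).toRingHom.comp restrictOp

theorem map_pGhost {A B : Type*} [Ring A] [Ring B] (f : A →+* B) (p : ℕ) (x : ℕ → A) (i : ℕ) :
    f (pGhost p x i) = pGhost p (fun j => f (x j)) i := by
  simp [pGhost]

/-- A representation of the `p`-typical generators `x_i`, `y_j` over a field of characteristic
`p`, together with commuting operators `t_j` which agree with the `y_j` on a cyclic vector. -/
theorem exists_modularModel.{u, v} (p : ℕ) [hp : Fact p.Prime] (K : Type u) [Field K] [CharP K p]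
    {c : ℕ+ → ℕ+ → MvPolynomial (ℕ+ ⊕ₗ ℕ+) ℤ} (hc : IsCFamily c) :
    ∃ (W : Type u) (_ : AddCommGroup W) (_ : Module K W) (x y t : ℕ → Module.End K W) (w : W),
      (∀ i i', Commute (x i) (x i')) ∧ (∀ j j', Commute (y j) (y j')) ∧
      (∀ j j', Commute (y j) (t j')) ∧ (∀ i j, Commute (x i) (t j)) ∧
      (∀ j, y j w = t j w) ∧
      (∀ i j, cEval (fun d => x (padicValNat p d)) (fun e => y (padicValNat p e))
        (c (ppow p i) (ppow p j)) = y j * x i - x i * y j) ∧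
      (∀ i s k, s < k → Commute (y s) (x i ^ p ^ k)) ∧
      (∀ i j l, i < l → Commute (x i) (y j ^ p ^ l)) ∧
      (∀ i j, y j ^ p ^ i * x i ^ p ^ j - x i ^ p ^ j * y j ^ p ^ i = 1) ∧
      ∀ {F : Type v} [Field F] [Algebra K F] (α β : ℕ → F),
        ∃ ψ : W →ₗ[K] F, ψ w = 1 ∧
          (∀ i v, ψ (x i v) = α i * ψ v) ∧ ∀ j v, ψ (t j v) = β j * ψ v := by
  let X' : ℕ+ → integralOps := fun d => ⟨mulOp (xPoly d), mulOp_mem_integralOps (xPoly_mem d)⟩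
  let T' : ℕ+ → integralOps := fun d => ⟨mulOp (tPoly d), mulOp_mem_integralOps (tPoly_mem d)⟩
  let Y' : ℕ+ → integralOps := fun d => ⟨yOp d, yOp_mem_integralOps hc d⟩
  let x' : ℕ → integralOps := fun i => X' (ppow p i)
  let y' : ℕ → integralOps := fun i => Y' (ppow p i)
  have hX : ∀ d e, Commute (X' d) (X' e) := fun d e => Subtype.ext (mulOp_commute _ _).eq
  have hY : ∀ d e, Commute (Y' d) (Y' e) := fun d e => Subtype.ext (yOp_commute _ _).eq
  have hYT : ∀ d e, Commute (Y' d) (T' e) := fun d e =>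
    Subtype.ext (yOp_commute_mulOp_tPoly _ _).eq
  have hXT : ∀ d e, Commute (X' d) (T' e) := fun d e => Subtype.ext (mulOp_commute _ _).eq
  have htf : ∀ g : integralOps, (p : integralOps) * g = 0 → g = 0 := fun g hg => by
    refine Subtype.ext (natCast_mul_cancel ⟨p, hp.out.pos⟩ ?_)
    have := congrArg Subtype.val hg
    simpa using this
  have hgx : ∀ i, (pGhost p x' i).1 = mulOp (X (Sum.inl (ppow p i))) := fun i => by
    rw [← ghost_mulOp_xPoly, ghost_ppow]
    exact map_pGhost integralOps.subtype p x' i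
  have hgy : ∀ i, (pGhost p y' i).1 = etaOp (ppow p i) := fun i => by
    rw [← ghost_yOp, ghost_ppow]
    exact map_pGhost integralOps.subtype p y' i
  have hne : ∀ i j, i ≠ j → Commute (pGhost p y' j) (pGhost p x' i) := fun i j hij => by
    refine Subtype.ext ?_
    rw [Subring.coe_mul, Subring.coe_mul, hgx, hgy, etaOp_mul_mulOp_inl, if_neg, add_zero]
    intro h
    have := congrArg (fun d : ℕ+ => padicValNat p d) h
    simp only [padicValNat_ppow] at this
    exact hij this
  have heq : ∀ i, pGhost p y' i * pGhost p x' i - pGhost p x' i * pGhost p y' i =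
      ((p ^ i : ℕ) : integralOps) := fun i => by
    refine Subtype.ext ?_
    rw [AddSubgroupClass.coe_sub, Subring.coe_mul, Subring.coe_mul, hgx, hgy, etaOp_mul_mulOp_inl,
      if_pos rfl, add_sub_cancel_left, coe_ppow]
    simp
  have hp0 : ((p : ℕ) : Module.End K (K ⊗[ℤ] wittCoord.range)) = 0 := by
    rw [← map_natCast (algebraMap K _), CharP.cast_eq_zero, map_zero]
  have hx' : ∀ i j, Commute (x' i) (x' j) := fun i j => hX _ _
  have hy' : ∀ i j, Commute (y' i) (y' j) := fun i j => hY _ _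
  let f := modularRep K
  refine ⟨K ⊗[ℤ] wittCoord.range, inferInstance, inferInstance,
    fun i => f (x' i), fun j => f (y' j), fun j => f (T' (ppow p j)), 1 ⊗ₜ 1,
    fun i i' => (hX _ _).map f, fun j j' => (hY _ _).map f, fun j j' => (hYT _ _).map f,
    fun i j => (hXT _ _).map f, fun j => ?_, fun i j => ?_,
    fun i s k hs => map_commute_pow htf hx' hne f hp0 hs i,
    fun i j l hi => map_commute_pow htf hy' (fun i j hij => (hne j i hij.symm).symm) f hp0 hi j,
    fun i j => map_commutator_pow htf hx' hne heq f hp0 j i, fun {F} _ _ α β => ?_⟩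
  · change (1 : K) ⊗ₜ[ℤ] restrictOp _ _ = (1 : K) ⊗ₜ[ℤ] restrictOp _ _
    congr 1
    refine Subtype.ext ?_
    change yOp _ 1 = tPoly _ * 1
    rw [yOp_one, mul_one]
  · rw [← map_mul, ← map_mul, ← map_sub]
    have h : cEval X' Y' (c (ppow p i) (ppow p j)) = y' j * x' i - x' i * y' j :=
      Subtype.ext ((map_cEval integralOps.subtype X' Y' _).trans (cEval_yOp hc _ _))
    rw [← h, map_cEval]
    refine cEval_ppow_congr hc (fun r _ => ?_) fun r _ => ?_ <;> simp only [padicValNat_ppow, x', y']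
  · let α' : ℕ+ ⊕ ℕ+ → F := Sum.elim (fun d => α (padicValNat p d)) fun d => β (padicValNat p d)
    let e := AlgEquiv.ofInjective wittCoord wittCoord_injective
    let ψ₀ : wittCoord.range →ₐ[ℤ] F := (aeval α').comp e.symm.toAlgHom
    have hex : ∀ v h, ψ₀ ⟨wittCoord (X v), h⟩ = α' v := fun v h => by
      have : e.symm ⟨wittCoord (X v), h⟩ = X v := e.symm_apply_apply (X v)
      change aeval α' (e.symm _) = _
      rw [this, aeval_X]
    have hmul : ∀ (v : ℕ+ ⊕ ℕ+) (T : integralOps), T.1 = mulOp (wittCoord (X v)) → ∀ w,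
        ψ₀.toLinearMap.liftBaseChange K (f T w) =
          α' v * ψ₀.toLinearMap.liftBaseChange K w := fun v T hT w => by
      induction w using TensorProduct.induction_on with
      | zero => simp
      | add u w hu hw => rw [map_add, map_add, hu, hw, map_add, mul_add]
      | tmul k w =>
        have h : restrictOp T w = ⟨wittCoord (X v), ⟨X v, rfl⟩⟩ * w := by
          refine Subtype.ext ?_
          rw [coe_restrictOp, hT]
          rfl
        change ψ₀.toLinearMap.liftBaseChange K (k ⊗ₜ restrictOp T w) = _
        rw [h, LinearMap.liftBaseChange_tmul, LinearMap.liftBaseChange_tmul]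
        simp only [AlgHom.toLinearMap_apply, map_mul, mul_smul_comm]
        exact congrArg (fun z => k • (z * ψ₀ w)) (hex v _)
    refine ⟨ψ₀.toLinearMap.liftBaseChange K, ?_, fun i v => ?_, fun j v => ?_⟩
    · rw [LinearMap.liftBaseChange_tmul]
      simp
    · rw [hmul (Sum.inl (ppow p i)) _ (by simp [x', X', wittCoord])]
      simp only [α', Sum.elim_inl, padicValNat_ppow]
    · rw [hmul (Sum.inr (ppow p j)) _ (by simp [T', wittCoord])]
      simp only [α', Sum.elim_inr, padicValNat_ppow]

end ModularModel

section FunctionalIdeal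

variable {K W F : Type*} [Field K] [AddCommGroup W] [Module K W] [Field F] [Algebra K F]
  (B : Subalgebra K (Module.End K W)) (ψ : W →ₗ[K] F) (w : W)

/-- The largest two-sided ideal of an algebra of operators on which the functional
`T ↦ ψ (T w)` vanishes. -/
def functionalIdeal : Ideal B where
  carrier := {T | ∀ S S' : B, ψ ((S.1 * T.1 * S'.1) w) = 0}
  zero_mem' S S' := by simp
  add_mem' {T T'} hT hT' S S' := by
    have := congrArg₂ (· + ·) (hT S S') (hT' S S')
    simpa [mul_add, add_mul] using this
  smul_mem' C T hT S S' := by simpa [mul_assoc] using hT (S * C) S'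

instance : (functionalIdeal B ψ w).IsTwoSided where
  mul_mem_of_left {T} C hT S S' := by simpa [mul_assoc] using hT S (C * S')

variable {B ψ w}

theorem functionalIdeal_ne_top (h : ψ w ≠ 0) : functionalIdeal B ψ w ≠ ⊤ := fun htop => by
  have : (1 : B) ∈ functionalIdeal B ψ w := htop ▸ Submodule.mem_top
  exact h (by simpa using this 1 1)

theorem sub_algebraMap_mem_functionalIdeal {T : B} {k : K} {u : Module.End K W}
    (hT : ∀ S : B, Commute T S) (hTu : T.1 w = u w) (hu : ∀ S ∈ B, Commute u S)
    (hψ : ∀ v, ψ (u v) = algebraMap K F k * ψ v) :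
    T - algebraMap K B k ∈ functionalIdeal B ψ w := by
  intro S S'
  have h1 : (S.1 * T.1 * S'.1) w = u ((S.1 * S'.1) w) := by
    have h2 : T.1 * S'.1 = S'.1 * T.1 := congrArg Subtype.val (hT S').eq
    rw [mul_assoc, h2, ← mul_assoc]
    change (S.1 * S'.1) (T.1 w) = _
    rw [hTu]
    exact (LinearMap.congr_fun (hu _ (B.mul_mem S.2 S'.2)).eq w).symm
  have h3 : (S.1 * (T - algebraMap K B k).1 * S'.1) w =
      (S.1 * T.1 * S'.1) w - k • (S.1 * S'.1) w := by
    simp [mul_sub, sub_mul]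
  rw [h3, h1, map_sub, hψ, map_smul, Algebra.smul_def, sub_self]

end FunctionalIdeal

theorem pow_apply_eq_of_commute {R W : Type*} [Semiring R] [AddCommMonoid W] [Module R W]
    {y t : Module.End R W} (h : Commute y t) {w : W} (hw : y w = t w) (e : ℕ) :
    (y ^ e) w = (t ^ e) w := by
  induction e with
  | zero => rfl
  | succ e ih =>
    rw [pow_succ', Module.End.mul_apply, ih]
    exact (LinearMap.congr_fun (h.pow_right e).eq w).trans
      ((congrArg (t ^ e) hw).trans (by rw [pow_succ, Module.End.mul_apply]))

theorem apply_pow_of_apply {R W F : Type*} [CommSemiring R] [AddCommMonoid W] [Module R W]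
    [CommSemiring F] [Module R F] {T : Module.End R W} {ψ : W →ₗ[R] F} {α : F}
    (h : ∀ v, ψ (T v) = α * ψ v) (e : ℕ) (v : W) : ψ ((T ^ e) v) = α ^ e * ψ v := by
  induction e with
  | zero => simp
  | succ e ih => rw [pow_succ', Module.End.mul_apply, h, ih, pow_succ', mul_assoc]

/-- A nontrivial algebra with elements satisfying the relations of `Asymb`, together with
the commutator relations between the `p`-power generators. -/
theorem exists_model.{u} (p : ℕ) [hp : Fact p.Prime] (K : Type u) [Field K] [CharP K p]
    {c : ℕ+ → ℕ+ → MvPolynomial (ℕ+ ⊕ₗ ℕ+) ℤ} (hc : IsCFamily c) (m n : ℕ) (a b : ℕ → K) :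
    ∃ (A : Type u) (_ : Ring A) (_ : Algebra K A) (_ : Nontrivial A) (x y : ℕ → A),
      (∀ i < m, ∀ i' < m, Commute (x i) (x i')) ∧ (∀ j < n, ∀ j' < n, Commute (y j) (y j')) ∧
      (∀ i < m, ∀ j < n, cEval (fun d => x (padicValNat p d)) (fun e => y (padicValNat p e))
        (c (ppow p i) (ppow p j)) = y j * x i - x i * y j) ∧
      (∀ i < m, x i ^ p ^ n = algebraMap K A (a i)) ∧
      (∀ j < n, y j ^ p ^ m = algebraMap K A (b j)) ∧
      (∀ i < m, ∀ s < n, ∀ k < n, s < k → Commute (y s) (x i ^ p ^ k)) ∧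
      (∀ i < m, ∀ j < n, ∀ l < m, i < l → Commute (x i) (y j ^ p ^ l)) ∧
      ∀ i < m, ∀ j < n, y j ^ p ^ i * x i ^ p ^ j - x i ^ p ^ j * y j ^ p ^ i = 1 := by
  obtain ⟨W, _, _, x, y, t, w, hxx, hyy, hyt, hxt, hyw, hcE, h1, h2, h3, hψ⟩ := exists_modularModel p K hc
  choose α hα using fun i => IsAlgClosed.exists_pow_nat_eq
    (algebraMap K (AlgebraicClosure K) (a i)) (pow_pos hp.out.pos n)
  choose β hβ using fun j => IsAlgClosed.exists_pow_nat_eq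
    (algebraMap K (AlgebraicClosure K) (b j)) (pow_pos hp.out.pos m)
  obtain ⟨ψ, hw, hψx, hψt⟩ := hψ α β
  let s : Set (Module.End K W) :=
    (fun i => x i ^ p ^ n) '' Set.Iio m ∪ (fun j => y j ^ p ^ m) '' Set.Iio n ∪ Set.range t
  let B := Subalgebra.centralizer K s
  have hs : ∀ z, (∀ i < m, Commute (x i ^ p ^ n) z) → (∀ j < n, Commute (y j ^ p ^ m) z) →
      (∀ j, Commute (t j) z) → z ∈ B := fun z hz1 hz2 hz3 => by
    rw [Subalgebra.mem_centralizer_iff]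
    rintro _ ((⟨i, hi, rfl⟩ | ⟨j, hj, rfl⟩) | ⟨j, rfl⟩)
    exacts [hz1 i hi, hz2 j hj, hz3 j]
  have hxB : ∀ i < m, x i ∈ B := fun i hi => hs _ (fun i' _ => (hxx i' i).pow_left _)
    (fun j _ => (h2 i j m hi).symm) fun j => (hxt i j).symm
  have hyB : ∀ j < n, y j ∈ B := fun j hj => hs _ (fun i _ => (h1 i j n hj).symm)
    (fun j' _ => (hyy j' j).pow_left _) fun j' => (hyt j j').symm
  have hBs : ∀ S ∈ B, ∀ g ∈ s, Commute g S := fun S hS => (Subalgebra.mem_centralizer_iff K).1 hS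
  let xB : ℕ → B := fun i => if h : i < m then ⟨x i, hxB i h⟩ else 0
  let yB : ℕ → B := fun j => if h : j < n then ⟨y j, hyB j h⟩ else 0
  have hxB' : ∀ i < m, (xB i).1 = x i := fun i hi => by simp [xB, hi]
  have hyB' : ∀ j < n, (yB j).1 = y j := fun j hj => by simp [yB, hj]
  let I := functionalIdeal B ψ w
  let π : B →ₐ[K] B ⧸ I := Ideal.Quotient.mkₐ K I
  have hI : I ≠ ⊤ := functionalIdeal_ne_top (by simp [hw])
  refine ⟨B ⧸ I, inferInstance, inferInstance, Ideal.Quotient.nontrivial_iff.2 hI,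
    fun i => π (xB i), fun j => π (yB j), fun i hi i' hi' => ?_, fun j hj j' hj' => ?_,
    fun i hi j hj => ?_, fun i hi => ?_, fun j hj => ?_, fun i hi s hs k _ hk => ?_,
    fun i hi j hj l _ hl => ?_, fun i hi j hj => ?_⟩
  · refine Commute.map (Subtype.ext ?_) π
    rw [MulMemClass.coe_mul, MulMemClass.coe_mul, hxB' i hi, hxB' i' hi']
    exact hxx i i'
  · refine Commute.map (Subtype.ext ?_) π
    rw [MulMemClass.coe_mul, MulMemClass.coe_mul, hyB' j hj, hyB' j' hj']
    exact hyy j j'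
  · rw [← map_mul, ← map_mul, ← map_sub]
    refine (map_cEval (π : B →+* B ⧸ I) (fun d => xB (padicValNat p d))
      (fun e => yB (padicValNat p e)) _).symm.trans (congrArg π (Subtype.ext ?_))
    refine (map_cEval (B.val : B →+* Module.End K _) _ _ _).trans (Eq.trans ?_
      ((hcE i j).trans ?_))
    · refine cEval_ppow_congr hc (fun r hr => ?_) fun r hr => ?_
      · simp only [padicValNat_ppow]
        exact hxB' r (hr.trans hi)
      · simp only [padicValNat_ppow]
        exact hyB' r (hr.trans hj)
    · rw [AddSubgroupClass.coe_sub, MulMemClass.coe_mul, MulMemClass.coe_mul, hxB' i hi, hyB' j hj]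
  · rw [← map_pow, ← sub_eq_zero, ← π.commutes, ← map_sub]
    refine Ideal.Quotient.eq_zero_iff_mem.2 (sub_algebraMap_mem_functionalIdeal (u := x i ^ p ^ n)
      (fun S => Subtype.ext ?_) ?_ (fun S hS => hBs S hS _ (.inl (.inl ⟨i, hi, rfl⟩))) fun v => ?_)
    · rw [MulMemClass.coe_mul, MulMemClass.coe_mul, SubmonoidClass.coe_pow, hxB' i hi]
      exact hBs S S.2 _ (.inl (.inl ⟨i, hi, rfl⟩))
    · rw [SubmonoidClass.coe_pow, hxB' i hi]
    · rw [apply_pow_of_apply (hψx i), hα]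
  · rw [← map_pow, ← sub_eq_zero, ← π.commutes, ← map_sub]
    refine Ideal.Quotient.eq_zero_iff_mem.2 (sub_algebraMap_mem_functionalIdeal (u := t j ^ p ^ m)
      (fun S => Subtype.ext ?_) ?_ (fun S hS => (hBs S hS _ (.inr ⟨j, rfl⟩)).pow_left _)
      fun v => ?_)
    · rw [MulMemClass.coe_mul, MulMemClass.coe_mul, SubmonoidClass.coe_pow, hyB' j hj]
      exact hBs S S.2 _ (.inl (.inr ⟨j, hj, rfl⟩))
    · rw [SubmonoidClass.coe_pow, hyB' j hj]
      exact pow_apply_eq_of_commute (hyt j j) (hyw j) _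
    · rw [apply_pow_of_apply (hψt j), hβ]
  · rw [← map_pow]
    refine Commute.map (Subtype.ext ?_) π
    rw [MulMemClass.coe_mul, MulMemClass.coe_mul, SubmonoidClass.coe_pow, hxB' i hi, hyB' s hs]
    exact h1 i s k hk
  · rw [← map_pow]
    refine Commute.map (Subtype.ext ?_) π
    rw [MulMemClass.coe_mul, MulMemClass.coe_mul, SubmonoidClass.coe_pow, hxB' i hi, hyB' j hj]
    exact h2 i j l hl
  · rw [← map_pow, ← map_pow, ← map_mul, ← map_mul, ← map_sub, ← map_one π]
    refine congrArg π (Subtype.ext ?_)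
    rw [AddSubgroupClass.coe_sub, MulMemClass.coe_mul, MulMemClass.coe_mul,
      SubmonoidClass.coe_pow, SubmonoidClass.coe_pow, hxB' i hi, hyB' j hj]
    exact h3 i j

section Asymb

variable (K : Type*) [Field K] (p : ℕ) [hp : Fact p.Prime]
  {c : ℕ+ → ℕ+ → MvPolynomial (ℕ+ ⊕ₗ ℕ+) ℤ} (m n : ℕ)
  (a : TruncatedWittVector p m K) (b : TruncatedWittVector p n K)

/-- The quotient map from the free algebra onto `Asymb`. -/
def asymbMk (c : ℕ+ → ℕ+ → MvPolynomial (ℕ+ ⊕ₗ ℕ+) ℤ) :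
    FreeAlgebra K (Fin m ⊕ Fin n) →ₐ[K] Asymb K p c m n a b :=
  (RingQuot.mkAlgHom K (ASRel K p c m n a b)).comp (RingQuot.mkAlgHom K (BmnRel K p c m n))

variable {K p m n a b}

theorem map_yx_iff (hc : IsCFamily c) {A : Type*} [Ring A] [Algebra K A] {x y : ℕ → A}
    (f : FreeAlgebra K (Fin m ⊕ Fin n) →ₐ[K] A)
    (hx : ∀ i : Fin m, f (FreeAlgebra.ι K (Sum.inl i)) = x i)
    (hy : ∀ j : Fin n, f (FreeAlgebra.ι K (Sum.inr j)) = y j) (i : Fin m) (j : Fin n) :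
    f (FreeAlgebra.ι K (Sum.inr j) * FreeAlgebra.ι K (Sum.inl i)) =
        f (FreeAlgebra.ι K (Sum.inl i) * FreeAlgebra.ι K (Sum.inr j) +
          cEval (sxm K p m n) (syn K p m n) (c (ppow p i) (ppow p j))) ↔
      cEval (fun d => x (padicValNat p d)) (fun e => y (padicValNat p e))
        (c (ppow p i) (ppow p j)) = y j * x i - x i * y j := by
  have h : f (cEval (sxm K p m n) (syn K p m n) (c (ppow p i) (ppow p j))) =
      cEval (fun d => x (padicValNat p d)) (fun e => y (padicValNat p e))
        (c (ppow p i) (ppow p j)) := by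
    refine (map_cEval (f : FreeAlgebra K (Fin m ⊕ Fin n) →+* A) _ _ _).trans ?_
    refine cEval_ppow_congr hc (fun r hr => ?_) fun r hr => ?_
    · simp only [sxm, padicValNat_ppow, dif_pos (hr.trans i.2)]
      exact hx ⟨r, hr.trans i.2⟩
    · simp only [syn, padicValNat_ppow, dif_pos (hr.trans j.2)]
      exact hy ⟨r, hr.trans j.2⟩
  rw [map_add, map_mul, map_mul, hx, hy, h, ← sub_eq_iff_eq_add', eq_comm]

theorem asymbMk_surjective : Function.Surjective (asymbMk K p m n a b c) :=
  (RingQuot.mkAlgHom_surjective K _).comp (RingQuot.mkAlgHom_surjective K _)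

theorem asymbMk_eq {u v : FreeAlgebra K (Fin m ⊕ Fin n)} (h : BmnRel K p c m n u v) :
    asymbMk K p m n a b c u = asymbMk K p m n a b c v :=
  congrArg (RingQuot.mkAlgHom K _) (RingQuot.mkAlgHom_rel K h)

theorem aX_mul_aX (i i' : Fin m) : aX K p c m n a b i * aX K p c m n a b i' =
    aX K p c m n a b i' * aX K p c m n a b i := by
  have := asymbMk_eq (a := a) (b := b) (.xx (c := c) i i')
  rwa [map_mul, map_mul] at this

theorem aY_mul_aY (j j' : Fin n) : aY K p c m n a b j * aY K p c m n a b j' =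
    aY K p c m n a b j' * aY K p c m n a b j := by
  have := asymbMk_eq (a := a) (b := b) (.yy (c := c) j j')
  rwa [map_mul, map_mul] at this

theorem aX_pow (i : Fin m) :
    aX K p c m n a b i ^ p ^ n = algebraMap K (Asymb K p c m n a b) (a.coeff i) := by
  have := RingQuot.mkAlgHom_rel K (ASRel.xa (c := c) (a := a) (b := b) i)
  rwa [map_pow, AlgHom.commutes] at this

theorem aY_pow (j : Fin n) :
    aY K p c m n a b j ^ p ^ m = algebraMap K (Asymb K p c m n a b) (b.coeff j) := by
  have := RingQuot.mkAlgHom_rel K (ASRel.yb (c := c) (a := a) (b := b) j)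
  rwa [map_pow, AlgHom.commutes] at this

theorem aY_mul_aX_sub (hc : IsCFamily c) {x y : ℕ → Asymb K p c m n a b}
    (hx : ∀ i : Fin m, x i = aX K p c m n a b i) (hy : ∀ j : Fin n, y j = aY K p c m n a b j)
    (i : Fin m) (j : Fin n) : cEval (fun d => x (padicValNat p d)) (fun e => y (padicValNat p e))
      (c (ppow p i) (ppow p j)) = y j * x i - x i * y j :=
  (map_yx_iff hc (asymbMk K p m n a b c) (fun i => (hx i).symm) (fun j => (hy j).symm) i j).1
    (asymbMk_eq (.yx i j))

theorem adjoin_range_aX_aY :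
    Algebra.adjoin K (Set.range (aX K p c m n a b) ∪ Set.range (aY K p c m n a b)) = ⊤ := by
  have h := congrArg (Subalgebra.map (asymbMk K p m n a b c)) (FreeAlgebra.adjoin_range_ι K _)
  rw [Algebra.map_top, (AlgHom.range_eq_top _).2 asymbMk_surjective, AlgHom.map_adjoin,
    ← Set.range_comp] at h
  rw [← h]
  congr 1
  rw [← Set.Sum.elim_range]
  congr 1
  ext (i | j) <;> rfl

/-- The universal property of `Asymb`. -/
theorem exists_asymb_algHom (hc : IsCFamily c) {A : Type*} [Ring A] [Algebra K A] {x y : ℕ → A}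
    (hx : ∀ i < m, ∀ i' < m, Commute (x i) (x i')) (hy : ∀ j < n, ∀ j' < n, Commute (y j) (y j'))
    (hyx : ∀ i < m, ∀ j < n, cEval (fun d => x (padicValNat p d)) (fun e => y (padicValNat p e))
        (c (ppow p i) (ppow p j)) = y j * x i - x i * y j)
    (ha : ∀ i : Fin m, x i ^ p ^ n = algebraMap K A (a.coeff i))
    (hb : ∀ j : Fin n, y j ^ p ^ m = algebraMap K A (b.coeff j)) :
    ∃ φ : Asymb K p c m n a b →ₐ[K] A, (∀ i, φ (aX K p c m n a b i) = x i) ∧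
      ∀ j, φ (aY K p c m n a b j) = y j := by
  let f : FreeAlgebra K (Fin m ⊕ Fin n) →ₐ[K] A :=
    FreeAlgebra.lift K (Sum.elim (fun i => x i) fun j => y j)
  have hfx : ∀ i, f (FreeAlgebra.ι K (Sum.inl i)) = x i := fun i => FreeAlgebra.lift_ι_apply _ _
  have hfy : ∀ j, f (FreeAlgebra.ι K (Sum.inr j)) = y j := fun j => FreeAlgebra.lift_ι_apply _ _
  have hf : ∀ ⦃u v⦄, BmnRel K p c m n u v → f u = f v := by
    rintro _ _ (⟨i, i'⟩ | ⟨j, j'⟩ | ⟨i, j⟩)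
    · simp only [map_mul, hfx]
      exact hx i i.2 i' i'.2
    · simp only [map_mul, hfy]
      exact hy j j.2 j' j'.2
    · exact (map_yx_iff hc f hfx hfy i j).2 (hyx i i.2 j j.2)
  let g : Bmn K p c m n →ₐ[K] A := RingQuot.liftAlgHom K ⟨f, hf⟩
  have hgx : ∀ i, g (gx K p c m n i) = x i := fun i =>
    (RingQuot.liftAlgHom_mkAlgHom_apply K f hf _).trans (hfx i)
  have hgy : ∀ j, g (gy K p c m n j) = y j := fun j =>
    (RingQuot.liftAlgHom_mkAlgHom_apply K f hf _).trans (hfy j)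
  have hg : ∀ ⦃u v⦄, ASRel K p c m n a b u v → g u = g v := by
    rintro _ _ (⟨i⟩ | ⟨j⟩)
    · rw [map_pow, hgx, ha, AlgHom.commutes]
    · rw [map_pow, hgy, hb, AlgHom.commutes]
  exact ⟨RingQuot.liftAlgHom K ⟨g, hg⟩,
    fun i => (RingQuot.liftAlgHom_mkAlgHom_apply K g hg _).trans (hgx i),
    fun j => (RingQuot.liftAlgHom_mkAlgHom_apply K g hg _).trans (hgy j)⟩

end Asymb

/-- Let `p` be a prime, `K` a field of characteristic `p`, `m, n ∈ ℕ`, `a ∈ W_m(K)` and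
`b ∈ W_n(K)`.  Then `A_{((a,b))_{p^m,p^n}}` is a central simple `K`-algebra of degree
`p^{mn}`: its center is exactly `K`, it has no two-sided ideals other than `0` and itself,
and its `K`-dimension is `p^{2mn}`. -/
theorem asymb_central_simple (p : ℕ) [Fact p.Prime] (K : Type*) [Field K] [CharP K p]
    (m n : ℕ) (c : ℕ+ → ℕ+ → MvPolynomial (ℕ+ ⊕ₗ ℕ+) ℤ) (hc : IsCFamily c)
    (a : TruncatedWittVector p m K) (b : TruncatedWittVector p n K) :
    Subalgebra.center K (Asymb K p c m n a b) = ⊥ ∧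
    IsSimpleRing (Asymb K p c m n a b) ∧
    Module.finrank K (Asymb K p c m n a b) = p ^ (2 * m * n) := by
  have hp : p.Prime := Fact.out
  let a' : ℕ → K := fun i => if h : i < m then a.coeff ⟨i, h⟩ else 0
  let b' : ℕ → K := fun j => if h : j < n then b.coeff ⟨j, h⟩ else 0
  let x : ℕ → Asymb K p c m n a b := fun i => if h : i < m then aX K p c m n a b ⟨i, h⟩ else 0
  let y : ℕ → Asymb K p c m n a b := fun j => if h : j < n then aY K p c m n a b ⟨j, h⟩ else 0
  have ha' : ∀ i : Fin m, a' i = a.coeff i := fun i => dif_pos i.2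
  have hb' : ∀ j : Fin n, b' j = b.coeff j := fun j => dif_pos j.2
  have hx' : ∀ i : Fin m, x i = aX K p c m n a b i := fun i => dif_pos i.2
  have hy' : ∀ j : Fin n, y j = aY K p c m n a b j := fun j => dif_pos j.2
  obtain ⟨A, _, _, _, u, v, huu, hvv, hvu, hu, hv, h1, h2, h3⟩ := exists_model p K hc m n a' b'
  obtain ⟨φ, hφx, hφy⟩ := exists_asymb_algHom (a := a) (b := b) hc huu hvv hvu
    (fun i => by rw [hu i i.2, ha']) fun j => by rw [hv j j.2, hb']
  have hφx : ∀ i < m, φ (x i) = u i := fun i hi => by rw [hx' ⟨i, hi⟩, hφx]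
  have hφy : ∀ j < n, φ (y j) = v j := fun j hj => by rw [hy' ⟨j, hj⟩, hφy]
  have hx : ∀ i < m, ∀ i' < m, Commute (x i) (x i') := fun i hi i' hi' => by
    rw [hx' ⟨i, hi⟩, hx' ⟨i', hi'⟩]
    exact aX_mul_aX _ _
  have hy : ∀ j < n, ∀ j' < n, Commute (y j) (y j') := fun j hj j' hj' => by
    rw [hy' ⟨j, hj⟩, hy' ⟨j', hj'⟩]
    exact aY_mul_aY _ _
  have htop : digitTower p 1 (chain p m n x y) (2 * (m * n)) = (⊤ : Submodule K _) := by
    refine digitTower_chain_eq_top hp.pos hx hy (a := a') (b := b') (fun i hi => ?_)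
      (fun j hj => ?_) (fun j hj i hi => ?_) ?_
    · rw [hx' ⟨i, hi⟩, aX_pow, ha' ⟨i, hi⟩]
    · rw [hy' ⟨j, hj⟩, aY_pow, hb' ⟨j, hj⟩]
    · rw [← aY_mul_aX_sub hc hx' hy' ⟨i, hi⟩ ⟨j, hj⟩]
      refine cEval_mem_mul _ _ (fun d hd => ?_) fun e he => ?_
      · obtain ⟨r, hr, rfl⟩ := exists_of_inl_mem_vars hc hd
        rw [padicValNat_ppow]
        exact Algebra.subset_adjoin ⟨r, hr.trans hi, rfl⟩
      · obtain ⟨r, hr, rfl⟩ := exists_of_inr_mem_vars hc he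
        rw [padicValNat_ppow]
        exact Algebra.subset_adjoin ⟨r, hr, rfl⟩
    · rw [eq_top_iff, ← adjoin_range_aX_aY]
      refine Algebra.adjoin_mono (Set.union_subset_union ?_ ?_)
      · rintro _ ⟨i, rfl⟩
        exact ⟨i, i.2, hx' i⟩
      · rintro _ ⟨j, rfl⟩
        exact ⟨j, j.2, hy' j⟩
  have h1 : ∀ i < m, ∀ s < n, ∀ k < n, s < k → Commute (φ (y s)) (φ (x i) ^ p ^ k) := by
    intro i hi s hs
    rw [hφx i hi, hφy s hs]
    exact h1 i hi s hs
  have h2 : ∀ i < m, ∀ j < n, ∀ l < m, i < l → Commute (φ (x i)) (φ (y j) ^ p ^ l) := by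
    intro i hi j hj
    rw [hφx i hi, hφy j hj]
    exact h2 i hi j hj
  have h3 : ∀ i < m, ∀ j < n, φ (y j) ^ p ^ i * φ (x i) ^ p ^ j -
      φ (x i) ^ p ^ j * φ (y j) ^ p ^ i = 1 := by
    intro i hi j hj
    rw [hφx i hi, hφy j hj]
    exact h3 i hi j hj
  have hφc : ∀ s, φ (chain p m n x y s) = chain p m n (fun i => φ (x i)) (fun j => φ (y j)) s :=
    map_chain p m n (φ : Asymb K p c m n a b →+* A) x y
  have hφ : Function.Injective φ := by
    refine injective_of_digitTower φ htop
      (gs := dualChain p m n (fun i => φ (x i)) fun j => φ (y j)) ?_ ?_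
    · simp only [hφc]
      exact chain_commutator h3
    · simp only [hφc]
      exact chain_commute (fun i hi i' hi' => (hx i hi i' hi').map φ) h1 h2
  have : Nontrivial (Asymb K p c m n a b) := φ.toRingHom.domain_nontrivial
  rw [mul_assoc]
  refine centralSimple_of_digitTower (gs := dualChain p m n x y) (chain_commutator fun i hi j hj =>
    hφ ?_) (chain_commute hx (fun i hi s hs k hk hsk => hφ ?_) fun i hi j hj l hl hil => hφ ?_) htop
  · simpa using h3 i hi j hj
  · simpa using (h1 i hi s hs k hk hsk).eq
  · simpa using (h2 i hi j hj l hl hil).eq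

end
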